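/- arXiv:2501.06888 — 2 statements merged into one kernel-verified Lean document; each statement's English description precedes it below -/
import Mathlib

section
/- Let n ≥ 2, let 𝒜 satisfy (H) for (k,l), let R be a pairing relation on E = {e_1, −e_1, …, e_n, −e_n}, and let ℰ be a covering of ℝ^n by curves without endpoints which is locally isomorphic to Â_R. Then there exists a sequence (x_s)_{s∈ℕ*} ⊆ ℤ^n such that Ω_{s,x_s}(ℰ) is isomorphic to 𝒜^s for each s ∈ ℕ*. -/
namespace Folding

noncomputable section

open Set

/-- Points of `ℝ^n` with the euclidean distance. -/
abbrev Pt (n : ℕ) := EuclideanSpace ℝ (Fin n)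

/-- `p` is a point of the lattice `ℤ^n`. -/
def latt {n : ℕ} (p : Pt n) : Prop := ∀ i, ∃ m : ℤ, p i = (m : ℝ)

/-- `p` belongs to `m·ℤ^n`. -/
def inLat {n : ℕ} (m : ℕ) (p : Pt n) : Prop := ∀ i, ∃ c : ℤ, p i = (m : ℝ) * (c : ℝ)

/-- The canonical basis vector `e_i`. -/
def uvec (n : ℕ) (i : Fin n) : Pt n := EuclideanSpace.single i (1 : ℝ)

/-- `u` belongs to `E = {e_1, -e_1, …, e_n, -e_n}`. -/
def IsDir {n : ℕ} (u : Pt n) : Prop := ∃ i, u = uvec n i ∨ u = -uvec n i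

/-- A (nonoriented) lattice segment `[x, x + e_i]`, as an unordered pair of endpoints. -/
def IsSeg {n : ℕ} (S : Sym2 (Pt n)) : Prop := ∃ x i, latt x ∧ S = s(x, x + uvec n i)

/-- A curve: a sequence of segments, indexed by an interval of `ℤ` (finite, ℕ-like or ℤ-like),
recorded through its sequence of vertices; two consecutive segments have exactly one common
endpoint, and the common endpoints with the preceding and the following segments differ
(`noback`). -/
structure Curve (n : ℕ) where
  dom : Set ℤ
  ordConn : dom.OrdConnected
  nontriv : ∃ i, i ∈ dom ∧ i + 1 ∈ dom
  v : ℤ → Pt n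
  lattice : ∀ i ∈ dom, latt (v i)
  step : ∀ i : ℤ, i ∈ dom → i + 1 ∈ dom →
    ∃ j, v (i + 1) = v i + uvec n j ∨ v (i + 1) = v i - uvec n j
  noback : ∀ i : ℤ, i - 1 ∈ dom → i + 1 ∈ dom → v (i + 1) ≠ v (i - 1)

namespace Curve

variable {n : ℕ} (c : Curve n)

/-- The segments of a curve. -/
def segs : Set (Sym2 (Pt n)) :=
  {S | ∃ i : ℤ, i ∈ c.dom ∧ i + 1 ∈ c.dom ∧ S = s(c.v i, c.v (i + 1))}

/-- The connexions between segments of a curve: pairs of consecutive segments. -/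
def conn (S T : Sym2 (Pt n)) : Prop :=
  ∃ i : ℤ, i - 1 ∈ c.dom ∧ i + 1 ∈ c.dom ∧
    ((S = s(c.v (i - 1), c.v i) ∧ T = s(c.v i, c.v (i + 1))) ∨
     (T = s(c.v (i - 1), c.v i) ∧ S = s(c.v i, c.v (i + 1))))

/-- A curve is self-avoiding if each of its segments appears only once. -/
def SelfAvoiding : Prop :=
  ∀ i j : ℤ, i ∈ c.dom → i + 1 ∈ c.dom → j ∈ c.dom → j + 1 ∈ c.dom →
    s(c.v i, c.v (i + 1)) = s(c.v j, c.v (j + 1)) → i = j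

/-- A curve without endpoints (indexed by `ℤ`). -/
def NoEndpts : Prop := c.dom = Set.univ

/-- `p` is an endpoint of the curve `c`. -/
def IsEndpt (p : Pt n) : Prop :=
  ∃ i ∈ c.dom, p = c.v i ∧ (i - 1 ∉ c.dom ∨ i + 1 ∉ c.dom)

/-- `S` is the end segment of `c` at its endpoint `p`. -/
def endSegAt (p : Pt n) (S : Sym2 (Pt n)) : Prop :=
  ∃ i : ℤ, i ∈ c.dom ∧ p = c.v i ∧
    ((i - 1 ∉ c.dom ∧ i + 1 ∈ c.dom ∧ S = s(c.v i, c.v (i + 1))) ∨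
     (i + 1 ∉ c.dom ∧ i - 1 ∈ c.dom ∧ S = s(c.v (i - 1), c.v i)))

/-- The number of segments (length) of a curve. -/
def nsegs : ℕ := {i : ℤ | i ∈ c.dom ∧ i + 1 ∈ c.dom}.ncard

end Curve

/-- The trace of a set of curves: its set of segments together with the connexion
relation between segments.  Two sets of curves are geometrically the same set of
(nonoriented) curves iff they have the same trace. -/
structure Trace (n : ℕ) where
  segs : Set (Sym2 (Pt n))
  conn : Sym2 (Pt n) → Sym2 (Pt n) → Prop

def curveTrace {n : ℕ} (c : Curve n) : Trace n := ⟨c.segs, c.conn⟩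

def traceOf {n : ℕ} (E : Set (Curve n)) : Trace n :=
  ⟨{S | ∃ c ∈ E, S ∈ c.segs}, fun S T => ∃ c ∈ E, c.conn S T⟩

/-- Two curves are the same nonoriented curve. -/
def SameCurve {n : ℕ} (c d : Curve n) : Prop := c.segs = d.segs ∧ c.conn = d.conn

/-- A set of pairwise disjoint self-avoiding curves. -/
def DisjSA {n : ℕ} (E : Set (Curve n)) : Prop :=
  (∀ c ∈ E, c.SelfAvoiding) ∧
  ∀ c ∈ E, ∀ d ∈ E, ¬ SameCurve c d → ∀ S, S ∈ c.segs → S ∉ d.segs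

/-- The set of points of `ℝ^n` lying on the segment `S`. -/
def segPts {n : ℕ} (S : Sym2 (Pt n)) : Set (Pt n) :=
  {p | ∃ a b, S = s(a, b) ∧ ∃ t : ℝ, 0 ≤ t ∧ t ≤ 1 ∧ p = a + t • (b - a)}

def Trace.pts {n : ℕ} (T : Trace n) : Set (Pt n) := ⋃ S ∈ T.segs, segPts S

/-- A set of curves covers `X ⊆ ℝ^n`: each lattice segment containing a point of `X`
appears in one and only one of the curves. -/
def Covers {n : ℕ} (E : Set (Curve n)) (X : Set (Pt n)) : Prop :=
  ∀ S, IsSeg S → (segPts S ∩ X).Nonempty →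
    (∃ c ∈ E, S ∈ c.segs) ∧ ∀ c ∈ E, ∀ d ∈ E, S ∈ c.segs → S ∈ d.segs → SameCurve c d

/-- A covering of `ℝ^n` by disjoint self-avoiding curves. -/
def IsCovering {n : ℕ} (E : Set (Curve n)) : Prop := DisjSA E ∧ Covers E Set.univ

/-- A single curve covers `X`. -/
def CurveCovers {n : ℕ} (c : Curve n) (X : Set (Pt n)) : Prop :=
  ∀ S, IsSeg S → (segPts S ∩ X).Nonempty → S ∈ c.segs

/-- `b` is a curve contained in the curve `a`. -/
def SubCurve {n : ℕ} (b a : Curve n) : Prop :=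
  b.segs ⊆ a.segs ∧ ∀ S T, b.conn S T → a.conn S T

/-- The relation `≺` at the level of traces. -/
def TPrec {n : ℕ} (T T' : Trace n) : Prop :=
  T.segs ⊆ T'.segs ∧ ∀ S S', T.conn S S' → T'.conn S S'

/-- `E ≺ F` : each segment of a curve of `E` is a segment of a curve of `F` and each
connexion between two segments of a curve of `E` also exists in `F`. -/
def Prec {n : ℕ} (E F : Set (Curve n)) : Prop := TPrec (traceOf E) (traceOf F)

/-- Image of a trace under a map of `ℝ^n`. -/
def Trace.map {n : ℕ} (f : Pt n → Pt n) (T : Trace n) : Trace n :=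
  ⟨Sym2.map f '' T.segs,
   fun S S' => ∃ A B, T.conn A B ∧ S = Sym2.map f A ∧ S' = Sym2.map f B⟩

/-- Translation of a trace by the vector `t`. -/
def Trace.transl {n : ℕ} (t : Pt n) (T : Trace n) : Trace n := T.map (fun p => p + t)

/-- Property (H) for the pair `(k, l)`. -/
def SatH {n : ℕ} (A : Set (Curve n)) (k l : ℕ) : Prop :=
  0 < k ∧ 0 < l ∧ k ∣ l ∧ IsCovering A ∧
  (∀ c ∈ A, c.dom.Finite ∧ ∃ x i, latt x ∧ inLat k x ∧ c.IsEndpt x ∧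
      c.IsEndpt (x + (k : ℝ) • uvec n i) ∧
      ∀ p, c.IsEndpt p → p = x ∨ p = x + (k : ℝ) • uvec n i) ∧
  (∀ (x : Pt n) (i : Fin n), latt x → inLat k x →
      (∃ c ∈ A, c.IsEndpt x ∧ c.IsEndpt (x + (k : ℝ) • uvec n i)) ∧
      ∀ c ∈ A, ∀ d ∈ A, c.IsEndpt x → c.IsEndpt (x + (k : ℝ) • uvec n i) →
        d.IsEndpt x → d.IsEndpt (x + (k : ℝ) • uvec n i) → SameCurve c d) ∧
  (∀ t : Pt n, inLat l t → Trace.transl t (traceOf A) = traceOf A)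

/-- The trace of the convolution product `A ∗ B`, where `A` satisfies (H) for `(k, l)`:
apply to `B` the homothety of center `0` and ratio `k`, then replace each resulting
segment by the curve of `A` having the same endpoints (connexions come from the curves
of `A`, together with the junctions of the end segments of consecutive `A`-curves). -/
def ConvTrace {n : ℕ} (k : ℕ) (A B : Set (Curve n)) : Trace n where
  segs := {S | ∃ a b : Pt n, s(a, b) ∈ (traceOf B).segs ∧
    ∃ c ∈ A, c.IsEndpt ((k : ℝ) • a) ∧ c.IsEndpt ((k : ℝ) • b) ∧ S ∈ c.segs}
  conn := fun S S' =>
    (∃ a b : Pt n, s(a, b) ∈ (traceOf B).segs ∧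
      ∃ c ∈ A, c.IsEndpt ((k : ℝ) • a) ∧ c.IsEndpt ((k : ℝ) • b) ∧ c.conn S S') ∨
    (∃ a b d : Pt n, (traceOf B).conn s(a, b) s(b, d) ∧
      ∃ c ∈ A, ∃ c' ∈ A, c.IsEndpt ((k : ℝ) • a) ∧ c.IsEndpt ((k : ℝ) • b) ∧
        c'.IsEndpt ((k : ℝ) • b) ∧ c'.IsEndpt ((k : ℝ) • d) ∧
        ((c.endSegAt ((k : ℝ) • b) S ∧ c'.endSegAt ((k : ℝ) • b) S') ∨
         (c.endSegAt ((k : ℝ) • b) S' ∧ c'.endSegAt ((k : ℝ) • b) S)))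

/-- The two-sided identity of the convolution product: the covering consisting of all
curves with one segment. -/
def unitTrace (n : ℕ) : Trace n := ⟨{S | IsSeg S}, fun _ _ => False⟩

/-- `P s` realizes the power `A^s` for the convolution product. -/
def PowersOf {n : ℕ} (A : Set (Curve n)) (k : ℕ) (P : ℕ → Set (Curve n)) : Prop :=
  (∀ s, DisjSA (P s)) ∧ traceOf (P 0) = unitTrace n ∧
  ∀ s, traceOf (P (s + 1)) = ConvTrace k A (P s)

/-- The trace of `Â`, the inductive limit of the `A^s` for `≺`. -/
def hatTrace {n : ℕ} (P : ℕ → Set (Curve n)) : Trace n :=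
  ⟨{S | ∃ s, S ∈ (traceOf (P s)).segs}, fun S T => ∃ s, (traceOf (P s)).conn S T⟩

/-- A pairing relation on `E = {e_1, -e_1, …, e_n, -e_n}`. -/
def IsPairing {n : ℕ} (R : Pt n → Pt n → Prop) : Prop :=
  (∀ u v, R u v → R v u) ∧ (∀ u v, R u v → IsDir u ∧ IsDir v) ∧
  (∀ u, ¬ R u u) ∧ ∀ u, IsDir u → ∃! v, R u v

/-- The trace of `Â_R` : `Â` with the segments with endpoint `0` connected according
to `R`. -/
def hatRTrace {n : ℕ} (P : ℕ → Set (Curve n)) (R : Pt n → Pt n → Prop) : Trace n :=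
  ⟨(hatTrace P).segs,
   fun S T => (hatTrace P).conn S T ∨
     ∃ u v, R u v ∧ S = s((0 : Pt n), u) ∧ T = s((0 : Pt n), v)⟩

/-- The cube `P_{x,h}`. -/
def cube {n : ℕ} (x : Pt n) (h : ℕ) : Set (Pt n) :=
  {p | ∀ i, x i - h ≤ p i ∧ p i ≤ x i + h}

/-- Restriction of a trace to a region `X` of `ℝ^n`. -/
def Trace.restr {n : ℕ} (T : Trace n) (X : Set (Pt n)) : Trace n :=
  ⟨{S | S ∈ T.segs ∧ segPts S ⊆ X},
   fun S S' => T.conn S S' ∧ segPts S ⊆ X ∧ segPts S' ⊆ X⟩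

/-- Condition (C). -/
def CondC {n : ℕ} (T : Trace n) : Prop :=
  ∀ (x : Pt n) (h : ℕ), latt x → 1 ≤ h →
    ∃ y : Pt n, latt y ∧ y ∉ cube x h ∧
      Trace.transl (y - x) (T.restr (cube x h)) = T.restr (cube y h)

/-- `(B(x,r) ∩ T, x) ≅ (B(y,r) ∩ T', y)` : the translation sending `x` to `y` maps
the part of `T` in the closed ball `B(x,r)` onto the part of `T'` in `B(y,r)`,
preserving the connexions between segments. -/
def BallIso {n : ℕ} (T : Trace n) (x : Pt n) (T' : Trace n) (y : Pt n) (r : ℝ) : Prop :=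
  (fun p => p + (y - x)) '' (T.pts ∩ Metric.closedBall x r) =
      T'.pts ∩ Metric.closedBall y r ∧
  (∀ S S', T.conn S S' → segPts S ⊆ Metric.closedBall x r →
      segPts S' ⊆ Metric.closedBall x r →
      T'.conn (Sym2.map (fun p => p + (y - x)) S) (Sym2.map (fun p => p + (y - x)) S')) ∧
  (∀ S S', T'.conn S S' → segPts S ⊆ Metric.closedBall y r →
      segPts S' ⊆ Metric.closedBall y r →
      T.conn (Sym2.map (fun p => p + (x - y)) S) (Sym2.map (fun p => p + (x - y)) S'))

/-- The local isomorphism property. -/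
def LocIsoProp {n : ℕ} (T : Trace n) : Prop :=
  ∀ (x : Pt n) (r : ℝ), 0 ≤ r →
    ∃ t : ℝ, 0 ≤ t ∧ ∀ y : Pt n, ∃ z ∈ Metric.closedBall y t, BallIso T x T z r

/-- Two traces are locally isomorphic. -/
def LocallyIso {n : ℕ} (T T' : Trace n) : Prop :=
  (∀ (x : Pt n) (r : ℝ), 0 ≤ r → ∃ y, BallIso T x T' y r) ∧
  (∀ (y : Pt n) (r : ℝ), 0 ≤ r → ∃ x, BallIso T' y T x r)

/-- `Ω_{s,x}` : suppress the connexions between segments whose common endpoint lies in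
`x + k^s ℤ^n`. -/
def OmegaTrace {n : ℕ} (k s : ℕ) (x : Pt n) (T : Trace n) : Trace n :=
  ⟨T.segs, fun S S' => T.conn S S' ∧ ¬ ∃ p, p ∈ S ∧ p ∈ S' ∧ inLat (k ^ s) (p - x)⟩

/-- `Σ_{s,x}(E)` : for each curve `D` of `E` passing through `x`, the curve(s) with
endpoint `x` contained in `D` having maximal length, this length being limited to
`8^s`. -/
def SigmaSet {n : ℕ} (s : ℕ) (x : Pt n) (E : Set (Curve n)) : Set (Curve n) :=
  {b | ∃ D ∈ E, SubCurve b D ∧ b.IsEndpt x ∧ b.nsegs ≤ 8 ^ s ∧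
    ∀ b' : Curve n, SubCurve b' D → b'.IsEndpt x → b'.nsegs ≤ 8 ^ s →
      SubCurve b b' → SameCurve b b'}

/-- A positive (orientation preserving) isometry of `ℝ^n`. -/
def PosIsom {n : ℕ} (f : Pt n → Pt n) : Prop :=
  ∃ (g : Pt n ≃ₗᵢ[ℝ] Pt n) (t : Pt n), (∀ x, f x = g x + t) ∧
    0 < LinearMap.det (g.toLinearEquiv.toLinearMap)

/-- `E` consists of exactly `m` curves. -/
def HasExactly {n : ℕ} (E : Set (Curve n)) (m : ℕ) : Prop :=
  ∃ L : List (Curve n), L.length = m ∧ (∀ c ∈ L, c ∈ E) ∧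
    L.Pairwise (fun c d => ¬ SameCurve c d) ∧ ∀ c ∈ E, ∃ d ∈ L, SameCurve c d

/-- `E` consists of at most `m` curves. -/
def AtMost {n : ℕ} (E : Set (Curve n)) (m : ℕ) : Prop :=
  ∃ L : List (Curve n), L.length ≤ m ∧ ∀ c ∈ E, ∃ d ∈ L, SameCurve c d

/-- The set of points of a curve. -/
def curvePts {n : ℕ} (c : Curve n) : Set (Pt n) := ⋃ S ∈ c.segs, segPts S


section Lattice

variable {n : ℕ}

lemma uvec_apply (i j : Fin n) : uvec n i j = if j = i then 1 else 0 := by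
  simp [uvec]

lemma uvec_ne_zero (i : Fin n) : uvec n i ≠ 0 := by
  intro h
  have := congrArg (fun p : Pt n => p i) h
  simp [uvec_apply] at this

lemma latt.add {p q : Pt n} (hp : latt p) (hq : latt q) : latt (p + q) := fun i => by
  obtain ⟨a, ha⟩ := hp i
  obtain ⟨b, hb⟩ := hq i
  exact ⟨a + b, by simp [ha, hb]⟩

lemma latt.neg {p : Pt n} (hp : latt p) : latt (-p) := fun i => by
  obtain ⟨a, ha⟩ := hp i
  exact ⟨-a, by simp [ha]⟩

lemma latt_zero : latt (0 : Pt n) := fun _ => ⟨0, by simp⟩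

lemma latt_uvec (i : Fin n) : latt (uvec n i) := fun j => by
  by_cases h : j = i
  · exact ⟨1, by simp [uvec_apply, h]⟩
  · exact ⟨0, by simp [uvec_apply, h]⟩

lemma inLat.add {m : ℕ} {p q : Pt n} (hp : inLat m p) (hq : inLat m q) : inLat m (p + q) :=
  fun i => by
    obtain ⟨a, ha⟩ := hp i
    obtain ⟨b, hb⟩ := hq i
    exact ⟨a + b, by simp [ha, hb, mul_add]⟩

lemma inLat.neg {m : ℕ} {p : Pt n} (hp : inLat m p) : inLat m (-p) := fun i => by
  obtain ⟨a, ha⟩ := hp i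
  exact ⟨-a, by simp [ha]⟩

lemma inLat.latt {m : ℕ} {p : Pt n} (hp : inLat m p) : latt p := fun i => by
  obtain ⟨a, ha⟩ := hp i
  exact ⟨m * a, by simp [ha]⟩

lemma inLat.of_dvd {m m' : ℕ} (h : m' ∣ m) {p : Pt n} (hp : inLat m p) : inLat m' p :=
  fun i => by
    obtain ⟨d, rfl⟩ := h
    obtain ⟨a, ha⟩ := hp i
    exact ⟨d * a, by rw [ha]; push_cast; ring⟩

lemma inLat_one_iff {p : Pt n} : inLat 1 p ↔ latt p := by
  simp [inLat, Folding.latt]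

lemma inLat_mul_smul {k m : ℕ} {p : Pt n} (hp : inLat m p) : inLat (k * m) ((k : ℝ) • p) :=
  fun i => by
    obtain ⟨a, ha⟩ := hp i
    exact ⟨a, by simp [ha, mul_assoc]⟩

lemma inLat_mul_smul_iff {k m : ℕ} (hk : 0 < k) {p : Pt n} :
    inLat (k * m) ((k : ℝ) • p) ↔ inLat m p := by
  refine ⟨fun h i => ?_, inLat_mul_smul⟩
  obtain ⟨a, ha⟩ := h i
  have hk' : (k : ℝ) ≠ 0 := by positivity
  refine ⟨a, mul_left_cancel₀ hk' ?_⟩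
  simpa [mul_assoc] using ha

lemma inLat_smul_uvec (k : ℕ) (i : Fin n) : inLat k ((k : ℝ) • uvec n i) := by
  simpa using inLat_mul_smul (k := k) (inLat_one_iff.2 (latt_uvec i))

lemma inLat.exists_smul {k m : ℕ} (hk : 0 < k) {p : Pt n} (hp : inLat (k * m) p) :
    ∃ q, inLat m q ∧ p = (k : ℝ) • q := by
  have hk' : (k : ℝ) ≠ 0 := by positivity
  have hpq : p = (k : ℝ) • ((k : ℝ)⁻¹ • p) := by rw [smul_inv_smul₀ hk']
  exact ⟨_, (inLat_mul_smul_iff hk).1 (hpq ▸ hp), hpq⟩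

end Lattice

section Translation

variable {n : ℕ}

/-- Translation of an unordered pair of points. -/
abbrev trSeg (t : Pt n) (S : Sym2 (Pt n)) : Sym2 (Pt n) := Sym2.map (fun p => p + t) S

lemma trSeg_trSeg (t u : Pt n) (S : Sym2 (Pt n)) : trSeg t (trSeg u S) = trSeg (u + t) S := by
  induction S with
  | _ a b => simp [trSeg, add_assoc]

lemma trSeg_zero (S : Sym2 (Pt n)) : trSeg 0 S = S := by
  induction S with
  | _ a b => simp [trSeg]

lemma trSeg_neg_trSeg (t : Pt n) (S : Sym2 (Pt n)) : trSeg (-t) (trSeg t S) = S := by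
  rw [trSeg_trSeg, add_neg_cancel, trSeg_zero]

lemma trSeg_trSeg_neg (t : Pt n) (S : Sym2 (Pt n)) : trSeg t (trSeg (-t) S) = S := by
  rw [trSeg_trSeg, neg_add_cancel, trSeg_zero]

lemma mem_trSeg {t p : Pt n} {S : Sym2 (Pt n)} : p ∈ trSeg t S ↔ p - t ∈ S := by
  induction S with
  | _ a b => simp [trSeg, sub_eq_iff_eq_add]

lemma add_mem_trSeg {t p : Pt n} {S : Sym2 (Pt n)} (h : p ∈ S) : p + t ∈ trSeg t S :=
  mem_trSeg.2 (by simpa using h)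

lemma IsSeg.trSeg {t : Pt n} (ht : latt t) {S : Sym2 (Pt n)} (hS : IsSeg S) :
    IsSeg (trSeg t S) := by
  obtain ⟨x, i, hx, rfl⟩ := hS
  exact ⟨x + t, i, hx.add ht, by simp [Folding.trSeg, add_right_comm]⟩

lemma IsSeg.latt {S : Sym2 (Pt n)} (hS : IsSeg S) {p : Pt n} (hp : p ∈ S) : latt p := by
  obtain ⟨x, i, hx, rfl⟩ := hS
  rcases Sym2.mem_iff.1 hp with rfl | rfl
  exacts [hx, hx.add (latt_uvec i)]

lemma segPts_mk_subset_closedBall {a b y : Pt n} {r : ℝ} (ha : dist a y ≤ r)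
    (hb : dist b y ≤ r) : segPts s(a, b) ⊆ Metric.closedBall y r := by
  have key : ∀ a b : Pt n, dist a y ≤ r → dist b y ≤ r → ∀ t : ℝ, 0 ≤ t → t ≤ 1 →
      a + t • (b - a) ∈ Metric.closedBall y r := fun a b ha hb t h0 h1 =>
    (convex_closedBall y r).add_smul_sub_mem (Metric.mem_closedBall.2 ha)
      (Metric.mem_closedBall.2 hb) ⟨h0, h1⟩
  rintro p ⟨a', b', hab, t, h0, h1, rfl⟩
  rcases Sym2.eq_iff.1 hab with ⟨rfl, rfl⟩ | ⟨rfl, rfl⟩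
  · exact key _ _ ha hb t h0 h1
  · exact key _ _ hb ha t h0 h1

lemma exists_segPts_trSeg_subset (S : Sym2 (Pt n)) :
    ∃ N : ℕ, ∀ r : ℕ, N ≤ r → ∀ y, segPts (trSeg y S) ⊆ Metric.closedBall y r := by
  induction S with
  | _ a b =>
    obtain ⟨N, hN⟩ := exists_nat_ge (max ‖a‖ ‖b‖)
    refine ⟨N, fun r hr y => ?_⟩
    have hr' : (N : ℝ) ≤ r := by exact_mod_cast hr
    have := max_le_iff.1 (hN.trans hr')
    exact segPts_mk_subset_closedBall (by simpa using this.1) (by simpa using this.2)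

lemma segPts_nonempty (S : Sym2 (Pt n)) : (segPts S).Nonempty := by
  induction S with
  | _ a b => exact ⟨a, a, b, rfl, 0, le_rfl, zero_le_one, by simp⟩

end Translation

section Curves

variable {n : ℕ}

namespace Curve

variable {c d : Curve n}

lemma mem_dom_of_mem {i : ℤ} (h₁ : i - 1 ∈ c.dom) (h₂ : i + 1 ∈ c.dom) : i ∈ c.dom :=
  c.ordConn.out h₁ h₂ ⟨by omega, by omega⟩

lemma v_succ_ne {i : ℤ} (h₁ : i ∈ c.dom) (h₂ : i + 1 ∈ c.dom) : c.v (i + 1) ≠ c.v i := by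
  obtain ⟨j, h | h⟩ := c.step i h₁ h₂ <;> rw [h] <;> simp [uvec_ne_zero]

lemma v_pred_ne {i : ℤ} (h₁ : i - 1 ∈ c.dom) (h₂ : i ∈ c.dom) : c.v i ≠ c.v (i - 1) := by
  simpa using c.v_succ_ne h₁ (by simpa using h₂)

lemma seg_mem {i : ℤ} (h₁ : i ∈ c.dom) (h₂ : i + 1 ∈ c.dom) :
    s(c.v i, c.v (i + 1)) ∈ c.segs := ⟨i, h₁, h₂, rfl⟩

lemma seg_mem' {i : ℤ} (h₁ : i - 1 ∈ c.dom) (h₂ : i ∈ c.dom) :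
    s(c.v (i - 1), c.v i) ∈ c.segs := ⟨i - 1, h₁, by simpa using h₂, by simp⟩

lemma isSeg_of_mem {S : Sym2 (Pt n)} (hS : S ∈ c.segs) : IsSeg S := by
  obtain ⟨i, h₁, h₂, rfl⟩ := hS
  obtain ⟨j, h | h⟩ := c.step i h₁ h₂
  · exact ⟨c.v i, j, c.lattice i h₁, by rw [h]⟩
  · exact ⟨c.v (i + 1), j, c.lattice _ h₂, by rw [h, Sym2.eq_swap]; simp⟩

lemma conn.symm {S T : Sym2 (Pt n)} (h : c.conn S T) : c.conn T S := by
  obtain ⟨i, h₁, h₂, h⟩ := h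
  exact ⟨i, h₁, h₂, h.symm⟩

lemma conn.mem_left {S T : Sym2 (Pt n)} (h : c.conn S T) : S ∈ c.segs := by
  obtain ⟨i, h₁, h₂, ⟨rfl, -⟩ | ⟨-, rfl⟩⟩ := h
  · exact seg_mem' h₁ (mem_dom_of_mem h₁ h₂)
  · exact seg_mem (mem_dom_of_mem h₁ h₂) h₂

/-- Two connected segments have exactly one common endpoint. -/
lemma conn.exists_common {S T : Sym2 (Pt n)} (h : c.conn S T) :
    ∃ q, ∀ p, (p ∈ S ∧ p ∈ T) ↔ p = q := by
  obtain ⟨i, h₁, h₂, h⟩ := h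
  have hi := mem_dom_of_mem h₁ h₂
  have e₁ := v_pred_ne h₁ hi
  have e₂ := v_succ_ne hi h₂
  have e₃ := c.noback i h₁ h₂
  refine ⟨c.v i, fun p => ?_⟩
  rcases h with ⟨rfl, rfl⟩ | ⟨rfl, rfl⟩ <;> simp only [Sym2.mem_iff] <;> grind

lemma endSegAt_of_forall {p : Pt n} {S : Sym2 (Pt n)} (hS : S ∈ c.segs) (hp : p ∈ S)
    (h : ∀ T, c.conn S T → p ∉ T) : c.endSegAt p S := by
  obtain ⟨i, h₁, h₂, rfl⟩ := hS
  rcases Sym2.mem_iff.1 hp with rfl | rfl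
  · refine ⟨i, h₁, rfl, Or.inl ⟨fun h₀ => ?_, h₂, rfl⟩⟩
    exact h s(c.v (i - 1), c.v i) ⟨i, h₀, h₂, Or.inr ⟨rfl, rfl⟩⟩ (by simp)
  · refine ⟨i + 1, h₂, rfl, Or.inr ⟨fun h₀ => ?_, by simpa using h₁, by simp⟩⟩
    exact h s(c.v (i + 1), c.v (i + 1 + 1))
      ⟨i + 1, by simpa using h₁, h₀, Or.inl ⟨by simp, rfl⟩⟩ (by simp)

lemma endSegAt.mem_segs {p : Pt n} {S : Sym2 (Pt n)} (h : c.endSegAt p S) : S ∈ c.segs := by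
  obtain ⟨i, hi, rfl, ⟨-, h₂, rfl⟩ | ⟨-, h₂, rfl⟩⟩ := h
  exacts [seg_mem hi h₂, seg_mem' h₂ hi]

lemma endSegAt.mem {p : Pt n} {S : Sym2 (Pt n)} (h : c.endSegAt p S) : p ∈ S := by
  obtain ⟨i, hi, rfl, ⟨-, h₂, rfl⟩ | ⟨-, h₂, rfl⟩⟩ := h <;> simp

lemma endSegAt.isEndpt {p : Pt n} {S : Sym2 (Pt n)} (h : c.endSegAt p S) : c.IsEndpt p := by
  obtain ⟨i, hi, rfl, ⟨h₁, -⟩ | ⟨h₁, -⟩⟩ := h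
  exacts [⟨i, hi, rfl, Or.inl h₁⟩, ⟨i, hi, rfl, Or.inr h₁⟩]

lemma endSegAt.not_mem_of_conn (hc : c.SelfAvoiding) {p : Pt n} {S T : Sym2 (Pt n)}
    (h : c.endSegAt p S) (hT : c.conn S T) : p ∉ T := by
  intro hpT
  have hpS := h.mem
  obtain ⟨q, hq⟩ := hT.exists_common
  have hpq := (hq p).1 ⟨hpS, hpT⟩
  subst hpq
  obtain ⟨j, j₁, j₂, hj⟩ := hT
  have hjd := mem_dom_of_mem j₁ j₂
  have hpj : c.v j = p := (hq _).1 (by rcases hj with ⟨rfl, rfl⟩ | ⟨rfl, rfl⟩ <;> simp)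
  have n₁ := c.v_pred_ne j₁ hjd
  have n₂ := c.v_succ_ne hjd j₂
  have e := fun i h₁ h₂ => hc i j h₁ h₂ hjd j₂
  have e' := fun i h₁ h₂ => hc i (j - 1) h₁ h₂ j₁ (by simpa using hjd)
  simp only [sub_add_cancel] at e'
  obtain ⟨i, hi, rfl, ⟨i₁, i₂, rfl⟩ | ⟨i₁, i₂, rfl⟩⟩ := h
  · rcases hj with ⟨hS, -⟩ | ⟨-, hS⟩
    · obtain rfl := e' i hi i₂ hS
      exact n₁ hpj
    · obtain rfl := e i hi i₂ hS
      exact i₁ j₁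
  · rcases hj with ⟨hS, -⟩ | ⟨-, hS⟩
    · obtain rfl : i = j := by
        have := e' (i - 1) i₂ (by simpa using hi) (by simpa using hS)
        omega
      exact i₁ j₂
    · obtain rfl : i - 1 = j := e (i - 1) i₂ (by simpa using hi) (by simpa using hS)
      simp only [sub_add_cancel] at n₂
      exact n₂ hpj.symm

lemma IsEndpt.exists_endSegAt {p : Pt n} (h : c.IsEndpt p) : ∃ S, c.endSegAt p S := by
  obtain ⟨i, hi, rfl, h⟩ := h
  obtain ⟨j, j₁, j₂⟩ := c.nontriv
  rcases h with h | h
  · have hij : i ≤ j := by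
      by_contra! hlt
      exact h (c.ordConn.out j₁ hi ⟨by omega, by omega⟩)
    exact ⟨_, i, hi, rfl, Or.inl ⟨h, c.ordConn.out hi j₂ ⟨by omega, by omega⟩, rfl⟩⟩
  · have hij : j + 1 ≤ i := by
      by_contra! hlt
      exact h (c.ordConn.out hi j₂ ⟨by omega, by omega⟩)
    exact ⟨_, i, hi, rfl, Or.inr ⟨h, c.ordConn.out j₁ hi ⟨by omega, by omega⟩, rfl⟩⟩

end Curve

variable {c d : Curve n}

lemma SameCurve.endSegAt (h : SameCurve c d) (hc : c.SelfAvoiding) {p : Pt n}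
    {S : Sym2 (Pt n)} (hS : c.endSegAt p S) : d.endSegAt p S :=
  Curve.endSegAt_of_forall (h.1 ▸ hS.mem_segs) hS.mem fun _ hT =>
    hS.not_mem_of_conn hc (h.2 ▸ hT)

lemma SameCurve.isEndpt (h : SameCurve c d) (hc : c.SelfAvoiding) {p : Pt n}
    (hp : c.IsEndpt p) : d.IsEndpt p := by
  obtain ⟨S, hS⟩ := hp.exists_endSegAt
  exact (h.endSegAt hc hS).isEndpt

lemma IsCovering.exists_mem {E : Set (Curve n)} (hE : IsCovering E) {S : Sym2 (Pt n)}
    (hS : IsSeg S) : ∃ c ∈ E, S ∈ c.segs :=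
  (hE.2 S hS (by simpa using segPts_nonempty S)).1

lemma IsCovering.sameCurve {E : Set (Curve n)} (hE : IsCovering E) (hc : c ∈ E) (hd : d ∈ E)
    {S : Sym2 (Pt n)} (hcS : S ∈ c.segs) (hdS : S ∈ d.segs) : SameCurve c d :=
  (hE.2 S (c.isSeg_of_mem hcS) (by simpa using segPts_nonempty S)).2 c hc d hd hcS hdS

lemma isSeg_of_mem_traceOf {E : Set (Curve n)} {S : Sym2 (Pt n)} (hS : S ∈ (traceOf E).segs) :
    IsSeg S := by
  obtain ⟨c, -, hc⟩ := hS
  exact c.isSeg_of_mem hc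

lemma IsCovering.traceOf_segs {E : Set (Curve n)} (hE : IsCovering E) :
    (traceOf E).segs = {S | IsSeg S} :=
  Set.ext fun _ => ⟨isSeg_of_mem_traceOf, hE.exists_mem⟩

end Curves

section PropertyH

variable {n : ℕ} {A : Set (Curve n)} {k l : ℕ} {c : Curve n}

/-- The signed basis vector `±e_i`. -/
def sdir (a : Fin n × Bool) : Pt n := if a.2 then uvec n a.1 else -uvec n a.1

lemma sdir_injective : Function.Injective (sdir (n := n)) := by
  rintro ⟨i, b⟩ ⟨j, b'⟩ h
  have hi := congrArg (fun p : Pt n => p i) h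
  by_cases hij : i = j
  · subst hij
    cases b <;> cases b' <;> simp [sdir, uvec_apply] at hi ⊢ <;> linarith
  · cases b <;> cases b' <;> simp [sdir, uvec_apply, hij] at hi

lemma sdir_ne_zero (a : Fin n × Bool) : sdir a ≠ 0 := by
  unfold sdir
  split_ifs <;> simp [uvec_ne_zero]

lemma IsSeg.exists_sdir {S : Sym2 (Pt n)} (hS : IsSeg S) {p : Pt n} (hp : p ∈ S) :
    ∃ a, S = s(p, p + sdir a) := by
  obtain ⟨x, i, hx, rfl⟩ := hS
  rcases Sym2.mem_iff.1 hp with rfl | rfl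
  · exact ⟨(i, true), by simp [sdir]⟩
  · exact ⟨(i, false), by simp [sdir, Sym2.eq_swap]⟩

lemma SatH.inLat_of_isEndpt (hA : SatH A k l) (hc : c ∈ A) {p : Pt n} (hp : c.IsEndpt p) :
    inLat k p := by
  obtain ⟨-, -, -, -, h, -⟩ := hA
  obtain ⟨-, x, i, -, hx, -, -, h⟩ := h c hc
  rcases h p hp with rfl | rfl
  exacts [hx, hx.add (inLat_smul_uvec k i)]

lemma SatH.isEndpt_unique (hA : SatH A k l) (hc : c ∈ A) {p q r : Pt n} (hp : c.IsEndpt p)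
    (hq : c.IsEndpt q) (hr : c.IsEndpt r) (hqp : q ≠ p) (hrp : r ≠ p) : q = r := by
  obtain ⟨-, -, -, -, h, -⟩ := hA
  obtain ⟨-, x, i, -, -, -, -, h⟩ := h c hc
  have := h p hp
  have := h q hq
  have := h r hr
  grind

lemma SatH.exists_curve (hA : SatH A k l) {p : Pt n} (hp : inLat k p) (a : Fin n × Bool) :
    ∃ d ∈ A, d.IsEndpt p ∧ d.IsEndpt (p + (k : ℝ) • sdir a) := by
  obtain ⟨-, -, -, -, -, h, -⟩ := hA
  obtain ⟨i, b⟩ := a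
  cases b
  · have hx : inLat k (p - (k : ℝ) • uvec n i) := by
      rw [sub_eq_add_neg]
      exact hp.add (inLat_smul_uvec k i).neg
    obtain ⟨⟨d, hd, h₁, h₂⟩, -⟩ := h _ i hx.latt hx
    exact ⟨d, hd, by simpa using h₂, by simpa [sdir, sub_eq_add_neg] using h₁⟩
  · obtain ⟨⟨d, hd, h₁, h₂⟩, -⟩ := h p i hp.latt hp
    exact ⟨d, hd, h₁, by simpa [sdir] using h₂⟩

/-- Every segment with an endpoint `p` in `kℤ^n` is the end segment at `p` of some curve. -/
lemma SatH.exists_endSegAt (hA : SatH A k l) {p : Pt n} (hp : inLat k p) {S : Sym2 (Pt n)}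
    (hS : IsSeg S) (hpS : p ∈ S) : ∃ d ∈ A, d.endSegAt p S := by
  have key : ∀ a, ∃ b, ∃ d ∈ A, d.IsEndpt p ∧ d.IsEndpt (p + (k : ℝ) • sdir a) ∧
      d.endSegAt p s(p, p + sdir b) := by
    intro a
    obtain ⟨d, hd, h₁, h₂⟩ := hA.exists_curve hp a
    obtain ⟨T, hT⟩ := h₁.exists_endSegAt
    obtain ⟨b, rfl⟩ := (d.isSeg_of_mem hT.mem_segs).exists_sdir hT.mem
    exact ⟨b, d, hd, h₁, h₂, hT⟩
  choose f d hd h₁ h₂ h₃ using key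
  have hk : (k : ℝ) ≠ 0 := by
    have := hA.1
    positivity
  have hf : Function.Injective f := by
    intro a b hab
    have hsame := hA.2.2.2.1.sameCurve (hd a) (hd b) (h₃ a).mem_segs
      (by rw [hab]; exact (h₃ b).mem_segs)
    have h := hA.isEndpt_unique (hd b) (h₁ b)
      (hsame.isEndpt (hA.2.2.2.1.1.1 _ (hd a)) (h₂ a)) (h₂ b)
      (by simp [hk, sdir_ne_zero]) (by simp [hk, sdir_ne_zero])
    exact sdir_injective (smul_right_injective _ hk (add_left_cancel h))
  obtain ⟨a, rfl⟩ := hS.exists_sdir hpS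
  obtain ⟨b, rfl⟩ := Finite.injective_iff_surjective.1 hf a
  exact ⟨d b, hd b, h₃ b⟩

lemma SatH.endSegAt (hA : SatH A k l) (hc : c ∈ A) {S : Sym2 (Pt n)} (hS : S ∈ c.segs)
    {p : Pt n} (hpS : p ∈ S) (hp : inLat k p) : c.endSegAt p S := by
  obtain ⟨d, hd, h⟩ := hA.exists_endSegAt hp (c.isSeg_of_mem hS) hpS
  exact (hA.2.2.2.1.sameCurve hd hc h.mem_segs hS).endSegAt (hA.2.2.2.1.1.1 d hd) h

/-- The inner vertices of the curves do not belong to `kℤ^n`. -/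
lemma SatH.not_inLat_of_conn (hA : SatH A k l) (hc : c ∈ A) {S T : Sym2 (Pt n)}
    (h : c.conn S T) {p : Pt n} (hpS : p ∈ S) (hpT : p ∈ T) : ¬ inLat k p := fun hp =>
  (hA.endSegAt hc h.mem_left hpS hp).not_mem_of_conn (hA.2.2.2.1.1.1 c hc) h hpT

lemma SatH.traceOf_conn_trSeg (hA : SatH A k l) {t : Pt n} (ht : inLat l t)
    {S T : Sym2 (Pt n)} (h : (traceOf A).conn S T) :
    (traceOf A).conn (trSeg t S) (trSeg t T) := by
  rw [← hA.2.2.2.2.2.2 t ht]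
  exact ⟨S, T, h, rfl, rfl⟩

/-- The translate of a curve by an element of `lℤ^n` is a curve of the set. -/
lemma SatH.exists_translate (hA : SatH A k l) {t : Pt n} (ht : inLat l t) (hc : c ∈ A) :
    ∃ d ∈ A, (∀ S T, c.conn S T → d.conn (trSeg t S) (trSeg t T)) ∧
      (∀ p S, c.endSegAt p S → d.endSegAt (p + t) (trSeg t S)) ∧
      ∀ p, c.IsEndpt p → d.IsEndpt (p + t) := by
  have hcov := hA.2.2.2.1
  obtain ⟨i₀, h₀, h₀'⟩ := c.nontriv
  obtain ⟨d, hd, hdS⟩ := hcov.exists_mem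
    ((c.isSeg_of_mem (c.seg_mem h₀ h₀')).trSeg ht.latt)
  have hconn : ∀ S T, c.conn S T → trSeg t S ∈ d.segs → d.conn (trSeg t S) (trSeg t T) := by
    intro S T h hS
    obtain ⟨e, he, h'⟩ := hA.traceOf_conn_trSeg ht ⟨c, hc, h⟩
    rw [← (hcov.sameCurve he hd h'.mem_left hS).2]
    exact h'
  have hup : ∀ i, i₀ ≤ i → i + 1 ∈ c.dom → trSeg t s(c.v i, c.v (i + 1)) ∈ d.segs := by
    intro i hi
    induction i, hi using Int.leInduction with
    | base => exact fun _ => hdS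
    | succ i hi ih =>
      intro hi₂
      have hi₁ : i + 1 ∈ c.dom := c.ordConn.out h₀ hi₂ ⟨by omega, by omega⟩
      have hi₀ : i ∈ c.dom := c.ordConn.out h₀ hi₂ ⟨by omega, by omega⟩
      exact (hconn _ _ ⟨i + 1, by simpa using hi₀, hi₂, Or.inl ⟨by simp, rfl⟩⟩
        (ih hi₁)).symm.mem_left
  have hdown : ∀ i, i ≤ i₀ → i ∈ c.dom → trSeg t s(c.v i, c.v (i + 1)) ∈ d.segs := by
    intro i hi
    induction i, hi using Int.leInductionDown with
    | base => exact fun _ => hdS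
    | pred i hi ih =>
      intro hi₀
      have hi₁ : i ∈ c.dom := c.ordConn.out hi₀ h₀ ⟨by omega, by omega⟩
      have hi₂ : i + 1 ∈ c.dom := c.ordConn.out hi₀ h₀' ⟨by omega, by omega⟩
      exact (hconn _ _ ⟨i, hi₀, hi₂, Or.inr ⟨by simp, rfl⟩⟩ (ih hi₁)).symm.mem_left
  have hsegs : ∀ S ∈ c.segs, trSeg t S ∈ d.segs := by
    rintro S ⟨i, h₁, h₂, rfl⟩
    rcases le_total i₀ i with h | h
    exacts [hup i h h₂, hdown i h h₁]
  have hend : ∀ p S, c.endSegAt p S → d.endSegAt (p + t) (trSeg t S) := fun p S h =>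
    hA.endSegAt hd (hsegs S h.mem_segs) (add_mem_trSeg h.mem)
      ((hA.inLat_of_isEndpt hc h.isEndpt).add (ht.of_dvd hA.2.2.1))
  refine ⟨d, hd, fun S T h => hconn S T h (hsegs S h.mem_left), hend, fun p h => ?_⟩
  obtain ⟨S, hS⟩ := h.exists_endSegAt
  exact (hend p S hS).isEndpt

end PropertyH

section Powers

variable {n : ℕ} {A : Set (Curve n)} {k l : ℕ} {P : ℕ → Set (Curve n)}

lemma PowersOf.segs_eq (hA : SatH A k l) (hP : PowersOf A k P) (s : ℕ) :
    (traceOf (P s)).segs = {S | IsSeg S} := by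
  induction s with
  | zero => rw [hP.2.1]; rfl
  | succ s ih =>
    refine Set.ext fun S => ⟨isSeg_of_mem_traceOf, fun hS => ?_⟩
    obtain ⟨c, hc, hcS⟩ := hA.2.2.2.1.exists_mem hS
    obtain ⟨-, x, i, -, hx, h₁, h₂, -⟩ := hA.2.2.2.2.1 c hc
    obtain ⟨a, ha, rfl⟩ := inLat.exists_smul (m := 1) hA.1 (by simpa using hx)
    rw [hP.2.2]
    refine ⟨a, a + uvec n i, ?_, c, hc, h₁, by simpa using h₂, hcS⟩
    rw [ih]
    exact ⟨a, i, inLat_one_iff.1 ha, rfl⟩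

lemma exists_common_of_traceOf_conn {E : Set (Curve n)} {S T : Sym2 (Pt n)}
    (h : (traceOf E).conn S T) : ∃ q, ∀ p, (p ∈ S ∧ p ∈ T) ↔ p = q := by
  obtain ⟨c, -, h⟩ := h
  exact h.exists_common

lemma isSeg_of_traceOf_conn {E : Set (Curve n)} {S T : Sym2 (Pt n)}
    (h : (traceOf E).conn S T) : IsSeg S ∧ IsSeg T := by
  obtain ⟨c, -, h⟩ := h
  exact ⟨c.isSeg_of_mem h.mem_left, c.isSeg_of_mem h.symm.mem_left⟩

/-- The power `A^s` has no connexion at the points of `k^sℤ^n`. -/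
lemma PowersOf.not_inLat_of_conn (hA : SatH A k l) (hP : PowersOf A k P) {s : ℕ}
    {S T : Sym2 (Pt n)} (h : (traceOf (P s)).conn S T) {p : Pt n} (hpS : p ∈ S) (hpT : p ∈ T) :
    ¬ inLat (k ^ s) p := by
  induction s generalizing S T p with
  | zero =>
    rw [hP.2.1] at h
    exact h.elim
  | succ s ih =>
    obtain ⟨q, hq⟩ := exists_common_of_traceOf_conn h
    rw [hP.2.2] at h
    rcases h with ⟨a, b, -, c, hc, -, -, h⟩ | ⟨a, b, d, h, c, -, c', -, -, -, -, -, h'⟩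
    · exact fun hp => hA.not_inLat_of_conn hc h hpS hpT (hp.of_dvd (dvd_pow_self k (by simp)))
    · have hb : (k : ℝ) • b ∈ S ∧ (k : ℝ) • b ∈ T := by
        rcases h' with ⟨h₁, h₂⟩ | ⟨h₁, h₂⟩
        exacts [⟨h₁.mem, h₂.mem⟩, ⟨h₂.mem, h₁.mem⟩]
      rw [(hq p).1 ⟨hpS, hpT⟩, ← (hq _).1 hb, pow_succ', inLat_mul_smul_iff hA.1]
      exact ih h (by simp) (by simp)

lemma PowersOf.conn_succ (hA : SatH A k l) (hP : PowersOf A k P) {s : ℕ} {S T : Sym2 (Pt n)}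
    (h : (traceOf (P s)).conn S T) : (traceOf (P (s + 1))).conn S T := by
  induction s generalizing S T with
  | zero =>
    rw [hP.2.1] at h
    exact h.elim
  | succ s ih =>
    rw [hP.2.2] at h ⊢
    rcases h with ⟨a, b, hab, h⟩ | ⟨a, b, d, hab, h⟩
    · rw [hP.segs_eq hA] at hab
      exact Or.inl ⟨a, b, by rwa [hP.segs_eq hA], h⟩
    · exact Or.inr ⟨a, b, d, ih hab, h⟩

lemma PowersOf.conn_mono (hA : SatH A k l) (hP : PowersOf A k P) {s m : ℕ} (hsm : s ≤ m)
    {S T : Sym2 (Pt n)} (h : (traceOf (P s)).conn S T) : (traceOf (P m)).conn S T := by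
  induction m, hsm using Nat.le_induction with
  | base => exact h
  | succ m _ ih => exact hP.conn_succ hA ih

/-- The connexions of `A^{s+j}` outside `k^sℤ^n` already exist in `A^s`. -/
lemma PowersOf.conn_of_add (hA : SatH A k l) (hP : PowersOf A k P) {s j : ℕ}
    {S T : Sym2 (Pt n)} (h : (traceOf (P (s + j))).conn S T) {p : Pt n} (hpS : p ∈ S)
    (hpT : p ∈ T) (hp : ¬ inLat (k ^ s) p) : (traceOf (P s)).conn S T := by
  induction s generalizing S T p with
  | zero => exact absurd (inLat_one_iff.2 ((isSeg_of_traceOf_conn h).1.latt hpS)) hp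
  | succ s ih =>
    obtain ⟨q, hq⟩ := exists_common_of_traceOf_conn h
    rw [add_right_comm, hP.2.2] at h
    rw [hP.2.2]
    rcases h with ⟨a, b, hab, h⟩ | ⟨a, b, d, hab, h⟩
    · rw [hP.segs_eq hA] at hab
      exact Or.inl ⟨a, b, by rwa [hP.segs_eq hA], h⟩
    · refine Or.inr ⟨a, b, d, ih hab (p := b) (by simp) (by simp) fun hb => hp ?_, h⟩
      obtain ⟨c, -, c', -, -, -, -, -, h'⟩ := h
      have hb' : (k : ℝ) • b ∈ S ∧ (k : ℝ) • b ∈ T := by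
        rcases h' with ⟨h₁, h₂⟩ | ⟨h₁, h₂⟩
        exacts [⟨h₁.mem, h₂.mem⟩, ⟨h₂.mem, h₁.mem⟩]
      rw [(hq p).1 ⟨hpS, hpT⟩, ← (hq _).1 hb', pow_succ']
      exact inLat_mul_smul hb

/-- The connexions of `A^s` are periodic. -/
lemma PowersOf.conn_trSeg (hA : SatH A k l) (hP : PowersOf A k P) {s : ℕ} {t : Pt n}
    (ht : inLat ((k * l) ^ s) t) {S T : Sym2 (Pt n)} (h : (traceOf (P s)).conn S T) :
    (traceOf (P s)).conn (trSeg t S) (trSeg t T) := by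
  induction s generalizing S T t with
  | zero =>
    rw [hP.2.1] at h
    exact h.elim
  | succ s ih =>
    have htl : inLat l t := ht.of_dvd ⟨(k * l) ^ s * k, by ring⟩
    obtain ⟨u, hu, rfl⟩ := inLat.exists_smul (k := k) (m := l * (k * l) ^ s) hA.1
      (ht.of_dvd (dvd_of_eq (by ring)))
    have hu' : inLat ((k * l) ^ s) u := hu.of_dvd (dvd_mul_left _ _)
    rw [hP.2.2] at h ⊢
    rcases h with ⟨a, b, hab, c, hc, h₁, h₂, h⟩ |
      ⟨a, b, d, hab, c, hc, c', hc', h₁, h₂, h₃, h₄, h⟩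
    · obtain ⟨e, he, e₁, -, e₃⟩ := hA.exists_translate htl hc
      refine Or.inl ⟨a + u, b + u, ?_, e, he, ?_, ?_, e₁ _ _ h⟩
      · rw [hP.segs_eq hA] at hab ⊢
        exact hab.trSeg hu'.latt
      · simpa using e₃ _ h₁
      · simpa using e₃ _ h₂
    · obtain ⟨e, he, -, e₂, e₃⟩ := hA.exists_translate htl hc
      obtain ⟨e', he', -, e₂', e₃'⟩ := hA.exists_translate htl hc'
      refine Or.inr ⟨a + u, b + u, d + u, by simpa using ih hu' hab, e, he, e', he', ?_, ?_, ?_, ?_,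
        ?_⟩
      · simpa using e₃ _ h₁
      · simpa using e₃ _ h₂
      · simpa using e₃' _ h₃
      · simpa using e₃' _ h₄
      · rw [smul_add]
        exact h.imp (fun h => ⟨e₂ _ _ h.1, e₂' _ _ h.2⟩) fun h => ⟨e₂ _ _ h.1, e₂' _ _ h.2⟩

/-- The connexions of `Â_R` outside `k^sℤ^n` are those of `A^s`. -/
lemma PowersOf.conn_of_hatRTrace (hA : SatH A k l) (hP : PowersOf A k P)
    {R : Pt n → Pt n → Prop} {s : ℕ} {S T : Sym2 (Pt n)} (h : (hatRTrace P R).conn S T)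
    (hST : ∀ p, p ∈ S → p ∈ T → ¬ inLat (k ^ s) p) : (traceOf (P s)).conn S T := by
  rcases h with ⟨m, h⟩ | ⟨u, v, -, rfl, rfl⟩
  · rcases le_total m s with hms | hsm
    · exact hP.conn_mono hA hms h
    · obtain ⟨q, hq⟩ := exists_common_of_traceOf_conn h
      obtain ⟨j, rfl⟩ := Nat.exists_eq_add_of_le hsm
      have hqST := (hq q).2 rfl
      exact hP.conn_of_add hA h hqST.1 hqST.2 (hST q hqST.1 hqST.2)
  · exact absurd (fun i => ⟨0, by simp⟩) (hST 0 (by simp) (by simp))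

end Powers

section LocalIsomorphism

variable {n : ℕ}

/-- A translation which maps the segments of the grid containing `0` into the grid is a
translation by a point of `ℤ^n`. -/
lemma latt_of_translate_subset (hn : 2 ≤ n) {y : Pt n}
    (h : ∀ (i : Fin n) (t : ℝ), 0 ≤ t → t ≤ 1 → ∃ S, IsSeg S ∧ t • uvec n i + y ∈ segPts S) :
    latt y := by
  intro j
  have : Nontrivial (Fin n) := Fin.nontrivial_iff_two_le.2 hn
  obtain ⟨i, hij⟩ := exists_ne j
  obtain ⟨t, h0, h1, ht⟩ : ∃ t : ℝ, 0 ≤ t ∧ t ≤ 1 ∧ ∀ m : ℤ, t + y i ≠ m := by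
    by_cases hy : ∃ m : ℤ, y i = m
    · obtain ⟨m, hm⟩ := hy
      refine ⟨1 / 2, by norm_num, by norm_num, fun m' h => ?_⟩
      have h2 : (1 : ℝ) = ((2 * (m' - m) : ℤ) : ℝ) := by push_cast; linarith
      have h3 : (1 : ℤ) = 2 * (m' - m) := by exact_mod_cast h2
      omega
    · exact ⟨0, le_rfl, zero_le_one, fun m h => hy ⟨m, by simpa using h⟩⟩
  obtain ⟨S, ⟨x, i', hx, rfl⟩, a, b, hab, u, -, -, hu⟩ := h i t h0 h1
  have hcoord : ∀ j', j' ≠ i' → (t • uvec n i + y) j' = x j' := by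
    intro j' hj'
    rw [hu]
    rcases Sym2.eq_iff.1 hab with ⟨rfl, rfl⟩ | ⟨rfl, rfl⟩ <;> simp [uvec_apply, hj']
  have hii' : i = i' := by
    by_contra hne
    obtain ⟨m, hm⟩ := hx i
    exact ht m (by simpa [uvec_apply, hm] using hcoord i hne)
  obtain ⟨m, hm⟩ := hx j
  exact ⟨m, by simpa [uvec_apply, hij.symm, hm] using hcoord j (hii' ▸ hij.symm)⟩

lemma BallIso.latt (hn : 2 ≤ n) {T T' : Trace n} (hT : {S | IsSeg S} ⊆ T.segs)
    (hT' : T'.segs ⊆ {S | IsSeg S}) {y : Pt n} {r : ℝ} (hr : 1 ≤ r)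
    (h : BallIso T 0 T' y r) : latt y := by
  refine latt_of_translate_subset hn fun i t h0 h1 => ?_
  have hmem : t • uvec n i ∈ T.pts ∩ Metric.closedBall 0 r := by
    refine ⟨Set.mem_biUnion (hT ⟨0, i, latt_zero, rfl⟩) ?_, ?_⟩
    · exact ⟨0, 0 + uvec n i, rfl, t, h0, h1, by simp⟩
    · simp only [mem_closedBall_zero_iff, norm_smul, uvec, Real.norm_eq_abs, abs_of_nonneg h0]
      simp
      linarith
  have := h.1.subset (Set.mem_image_of_mem _ hmem)
  obtain ⟨S, hS, hp⟩ := Set.mem_iUnion₂.1 this.1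
  exact ⟨S, hT' hS, by simpa using hp⟩

/-- Among a sequence of lattice points, infinitely many are congruent modulo `L`. -/
lemma exists_frequently_inLat_sub {L : ℕ} (hL : 0 < L) {y : ℕ → Pt n} (hy : ∀ r, latt (y r)) :
    ∃ r₀, ∀ N, ∃ r, N ≤ r ∧ inLat L (y r - y r₀) := by
  have : NeZero L := ⟨hL.ne'⟩
  choose m hm using hy
  obtain ⟨c, hc⟩ := Finite.exists_infinite_fiber fun (r : ℕ) (i : Fin n) => (m r i : ZMod L)
  have hc' := Set.infinite_coe_iff.1 hc
  obtain ⟨r₀, hr₀⟩ := hc'.nonempty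
  refine ⟨r₀, fun N => ?_⟩
  obtain ⟨r, hr, hNr⟩ := hc'.exists_gt N
  refine ⟨r, hNr.le, fun i => ?_⟩
  have h : (m r₀ i : ZMod L) = (m r i : ZMod L) :=
    congrFun ((show _ = c from hr₀).trans (show _ = c from hr).symm) i
  obtain ⟨d, hd⟩ := (ZMod.intCast_eq_intCast_iff_dvd_sub _ _ _).1 h
  refine ⟨d, ?_⟩
  rw [PiLp.sub_apply, hm, hm]
  exact_mod_cast hd

end LocalIsomorphism

section Main

variable {n : ℕ}

lemma Trace.eq_of_forall {T T' : Trace n} (h : T.segs = T'.segs)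
    (h' : ∀ S S', T.conn S S' ↔ T'.conn S S') : T = T' := by
  obtain ⟨s, c⟩ := T
  obtain ⟨s', c'⟩ := T'
  obtain rfl : s = s' := h
  obtain rfl : c = c' := funext₂ fun S S' => propext (h' S S')
  rfl

lemma BallIso.conn_iff {T T' : Trace n} {y : Pt n} {r : ℝ} (h : BallIso T 0 T' y r)
    {S S' : Sym2 (Pt n)} (hS : ∀ z, segPts (trSeg z S) ⊆ Metric.closedBall z r)
    (hS' : ∀ z, segPts (trSeg z S') ⊆ Metric.closedBall z r) :
    T.conn S S' ↔ T'.conn (trSeg y S) (trSeg y S') := by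
  constructor
  · intro hc
    have := h.2.1 S S' hc (by simpa only [trSeg_zero] using hS 0)
      (by simpa only [trSeg_zero] using hS' 0)
    rwa [sub_zero] at this
  · intro hc
    have := h.2.2 _ _ hc (hS y) (hS' y)
    rw [zero_sub] at this
    simpa only [trSeg_neg_trSeg] using this

/-- If the restrictions of `T` to large balls are translates of restrictions of `Â_R` by vectors
congruent to `c` modulo a period of `A^s`, then `Ω_{s,-c}(T)` is the translate of `A^s` by `-c`. -/
lemma transl_omegaTrace_eq {A : Set (Curve n)} {k l : ℕ} (hA : SatH A k l)
    {P : ℕ → Set (Curve n)} (hP : PowersOf A k P) {R : Pt n → Pt n → Prop} {s : ℕ}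
    {T : Trace n} (hT : T.segs = {S | IsSeg S}) {c : Pt n} (hc : latt c)
    (h : ∀ N : ℕ, ∃ r y, N ≤ r ∧ inLat ((k * l) ^ s) (y - c) ∧
      BallIso T 0 (hatRTrace P R) y (r : ℕ)) :
    Trace.transl c (OmegaTrace k s (-c) T) = traceOf (P s) := by
  have key : ∀ S S' : Sym2 (Pt n), ∃ y, inLat ((k * l) ^ s) (y - c) ∧
      (T.conn S S' ↔ (hatRTrace P R).conn (trSeg y S) (trSeg y S')) := by
    intro S S'
    obtain ⟨N, hN⟩ := exists_segPts_trSeg_subset S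
    obtain ⟨N', hN'⟩ := exists_segPts_trSeg_subset S'
    obtain ⟨r, y, hr, hy, hiso⟩ := h (max N N')
    exact ⟨y, hy, hiso.conn_iff (hN r (le_of_max_le_left hr)) (hN' r (le_of_max_le_right hr))⟩
  have hdvd : k ^ s ∣ (k * l) ^ s := pow_dvd_pow_of_dvd (dvd_mul_right k l) s
  refine Trace.eq_of_forall ?_ fun S' T' => ⟨?_, fun hconn => ?_⟩
  · rw [hP.segs_eq hA]
    ext S
    constructor
    · rintro ⟨S, hS, rfl⟩
      exact IsSeg.trSeg hc (hT.subset hS)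
    · exact fun hS => ⟨trSeg (-c) S, hT.superset (IsSeg.trSeg hc.neg hS), trSeg_trSeg_neg c S⟩
  · rintro ⟨S, S', ⟨hconn, hS⟩, rfl, rfl⟩
    obtain ⟨y, hy, hiff⟩ := key S S'
    have hconn' := hP.conn_of_hatRTrace (s := s) hA (hiff.1 hconn) fun p hp hp' hlat =>
      hS ⟨p - y, mem_trSeg.1 hp, mem_trSeg.1 hp', by
        have := hlat.add (hy.neg.of_dvd hdvd)
        convert this using 1
        abel⟩
    have := hP.conn_trSeg hA hy.neg hconn'
    rw [trSeg_trSeg, trSeg_trSeg] at this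
    simpa using this
  · obtain ⟨y, hy, hiff⟩ := key (trSeg (-c) S') (trSeg (-c) T')
    refine ⟨trSeg (-c) S', trSeg (-c) T', ⟨hiff.2 (Or.inl ⟨s, ?_⟩), ?_⟩,
      (trSeg_trSeg_neg c S').symm, (trSeg_trSeg_neg c T').symm⟩
    · rw [trSeg_trSeg, trSeg_trSeg, neg_add_eq_sub]
      exact hP.conn_trSeg hA hy hconn
    · rintro ⟨p, hp, hp', hlat⟩
      rw [mem_trSeg] at hp hp'
      exact hP.not_inLat_of_conn hA hconn hp hp' hlat

end Main

/-- Theorem 1.3: if `ℰ` is a covering of `ℝ^n` by curves without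
endpoints which is locally isomorphic to some `Â_R`, then there exists a sequence
`(x_s)_{s ∈ ℕ*} ⊆ ℤ^n` such that `Ω_{s,x_s}(ℰ) ≅ 𝒜^s` for each `s ∈ ℕ*`. -/
theorem statement6 {n : ℕ} (hn : 2 ≤ n) (A : Set (Curve n)) (k l : ℕ)
    (hA : SatH A k l) (P : ℕ → Set (Curve n)) (hP : PowersOf A k P)
    (R : Pt n → Pt n → Prop) (hR : IsPairing R)
    (E : Set (Curve n)) (hE : IsCovering E) (hEne : ∀ c ∈ E, c.NoEndpts)
    (hloc : LocallyIso (traceOf E) (hatRTrace P R)) :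
    ∃ x : ℕ → Pt n, ∀ s : ℕ, 1 ≤ s → latt (x s) ∧
      ∃ t : Pt n, latt t ∧
        Trace.transl t (OmegaTrace k s (x s) (traceOf E)) = traceOf (P s) := by
  have hEsegs := hE.traceOf_segs
  have hhat : (hatRTrace P R).segs ⊆ {S | IsSeg S} := by
    rintro S ⟨s, hS⟩
    exact isSeg_of_mem_traceOf hS
  choose y hy using fun r : ℕ => hloc.1 0 ((r + 1 : ℕ) : ℝ) (Nat.cast_nonneg _)
  have hlatt : ∀ r, latt (y r) := fun r =>
    (hy r).latt hn hEsegs.superset hhat (by simp)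
  have hpos : 0 < k * l := Nat.mul_pos hA.1 hA.2.1
  choose r₀ hr₀ using fun s : ℕ => exists_frequently_inLat_sub (pow_pos hpos s) hlatt
  refine ⟨fun s => -y (r₀ s), fun s _ => ⟨(hlatt _).neg, y (r₀ s), hlatt _, ?_⟩⟩
  refine transl_omegaTrace_eq hA hP (R := R) hEsegs (hlatt _) fun N => ?_
  obtain ⟨r, hNr, hr⟩ := hr₀ s N
  exact ⟨r + 1, y r, by omega, hr, hy r⟩

end
end Folding
end

section
/- Let g be the positive isometry of ℝ^3 fixing 0 with g(e_1) = −e_2, g(e_2) = −e_1, g(e_3) = −e_3, and set 𝒞_1 = 𝒞 and 𝒞_2 = g(𝒞). Then 𝒞_1 and 𝒞_2 are two equivalent coverings of ℝ^3 by curves equivalent to C, both containing the curve C; each 𝒞_i satisfies 4ℤ^3 + 𝒞_i = 𝒞_i; for each 𝒞_i, every point x = (2k,2l,2m) with k,l,m ∈ ℤ and k+l+m even (resp. odd) is an endpoint of type 0 (resp. type 1) of exactly 6 curves of 𝒞_i, and no other point of ℤ^3 is an endpoint of a curve of 𝒞_i. -/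
namespace Folding

noncomputable section

open Set

-- ℝ³-specific part
def toPt3 (f : Fin 3 → ℝ) : Pt 3 := (WithLp.equiv 2 (Fin 3 → ℝ)).symm f

def p3 (a b c : ℤ) : Pt 3 := toPt3 ![(a : ℝ), (b : ℝ), (c : ℝ)]

/-- The vertices of the curve `C`. -/
def CList : List (Pt 3) :=
  [p3 0 0 0, p3 0 (-1) 0, p3 0 (-1) (-1), p3 0 0 (-1), p3 1 0 (-1),
   p3 1 (-1) (-1), p3 1 (-1) 0, p3 1 0 0, p3 2 0 0]

/-- The block `ℬ₀` : six curves given by their lists of successive vertices. -/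
def B0 : List (List (Pt 3)) :=
  [ CList,
    [p3 0 0 0, p3 0 0 1, p3 0 1 1, p3 0 1 0, p3 (-1) 1 0, p3 (-1) 1 1,
     p3 (-1) 0 1, p3 (-1) 0 0, p3 (-2) 0 0],
    [p3 0 0 0, p3 0 0 (-1), p3 (-1) 0 (-1), p3 (-1) 0 0, p3 (-1) 1 0,
     p3 (-1) 1 (-1), p3 0 1 (-1), p3 0 1 0, p3 0 2 0],
    [p3 0 0 0, p3 1 0 0, p3 1 0 1, p3 0 0 1, p3 0 (-1) 1, p3 1 (-1) 1,
     p3 1 (-1) 0, p3 0 (-1) 0, p3 0 (-2) 0],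
    [p3 0 0 0, p3 (-1) 0 0, p3 (-1) (-1) 0, p3 0 (-1) 0, p3 0 (-1) 1,
     p3 (-1) (-1) 1, p3 (-1) 0 1, p3 0 0 1, p3 0 0 2],
    [p3 0 0 0, p3 0 1 0, p3 1 1 0, p3 1 0 0, p3 1 0 (-1), p3 1 1 (-1),
     p3 0 1 (-1), p3 0 0 (-1), p3 0 0 (-2)] ]

def sigma3 : Pt 3 → Pt 3 := fun x => toPt3 ![x 0, -(x 1), -(x 2)]
def tau3 : Pt 3 → Pt 3 := fun x => toPt3 ![x 0, x 2, -(x 1)]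
def ups3 : Pt 3 → Pt 3 := fun x => toPt3 ![x 0, -(x 2), x 1]

/-- The four blocks `ℬ₀, ℬ₁, ℬ₂, ℬ₃`. -/
def blockLists : Fin 4 → List (List (Pt 3)) :=
  ![B0,
    B0.map (List.map fun p => p3 2 2 0 + sigma3 p),
    B0.map (List.map fun p => p3 2 0 2 + tau3 p),
    B0.map (List.map fun p => p3 0 2 2 + ups3 p)]

def listSegs (L : List (Pt 3)) : Set (Sym2 (Pt 3)) :=
  {S | ∃ j : ℕ, j + 1 < L.length ∧ S = s(L.getD j 0, L.getD (j + 1) 0)}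

def listConn (L : List (Pt 3)) (S T : Sym2 (Pt 3)) : Prop :=
  ∃ j : ℕ, j + 2 < L.length ∧
    ((S = s(L.getD j 0, L.getD (j + 1) 0) ∧ T = s(L.getD (j + 1) 0, L.getD (j + 2) 0)) ∨
     (T = s(L.getD j 0, L.getD (j + 1) 0) ∧ S = s(L.getD (j + 1) 0, L.getD (j + 2) 0)))

/-- The trace of the curve given by a list of successive vertices. -/
def listTrace (L : List (Pt 3)) : Trace 3 := ⟨listSegs L, listConn L⟩

/-- The trace of the covering `𝒞 = ⋃_{u ∈ ℤ³, 0 ≤ i ≤ 3} (4u + ℬ_i)`. -/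
def CTrace : Trace 3 where
  segs := {S | ∃ u : Pt 3, latt u ∧ ∃ (i : Fin 4), ∃ M ∈ blockLists i,
    S ∈ (Trace.transl ((4 : ℝ) • u) (listTrace M)).segs}
  conn := fun S T => ∃ u : Pt 3, latt u ∧ ∃ (i : Fin 4), ∃ M ∈ blockLists i,
    (Trace.transl ((4 : ℝ) • u) (listTrace M)).conn S T

open Classical in
/-- The permutation `θ` of `E` with `θ(e₁) = -e₂`, `θ(e₂) = -e₃`, `θ(e₃) = -e₁`
and `θ² = Id`. -/
def theta3 : Pt 3 → Pt 3 := fun u =>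
  if u = uvec 3 0 then -uvec 3 1
  else if u = -uvec 3 1 then uvec 3 0
  else if u = uvec 3 1 then -uvec 3 2
  else if u = -uvec 3 2 then uvec 3 1
  else if u = uvec 3 2 then -uvec 3 0
  else if u = -uvec 3 0 then uvec 3 2
  else u

/-- `R^θ`. -/
def Rtheta (R : Pt 3 → Pt 3 → Prop) : Pt 3 → Pt 3 → Prop :=
  fun u v => R (theta3 u) (theta3 v)

def Rx (P : ℕ → Set (Curve 3)) (x : Pt 3) : Pt 3 → Pt 3 → Prop :=
  fun u v => (hatTrace P).conn s(x, x + u) s(x, x + v)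

/-- Condition (P). -/
def SatP (P : ℕ → Set (Curve 3)) (R : Pt 3 → Pt 3 → Prop) : Prop :=
  ∃ x : Pt 3, (∀ i, x i = -2 ∨ x i = 0 ∨ x i = 2 ∨ x i = 4) ∧
    (¬ ∀ i, x i = 0 ∨ x i = 4) ∧ (Rx P x = R ∨ Rx P x = Rtheta R)

/-- The trace of `Ĉ_X`, the inductive limit of the sets `x_s + 𝒞^s`. -/
def hatXTrace (P : ℕ → Set (Curve 3)) (x : ℕ → Pt 3) : Trace 3 :=
  ⟨{S | ∃ s, 1 ≤ s ∧ S ∈ (Trace.transl (x s) (traceOf (P s))).segs},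
   fun S T => ∃ s, 1 ≤ s ∧ (Trace.transl (x s) (traceOf (P s))).conn S T⟩

/-- The curve `c` is equivalent to `C` (image of `C` by a positive isometry). -/
def EquivToC (c : Curve 3) : Prop :=
  ∃ f, PosIsom f ∧ curveTrace c = Trace.map f (listTrace CList)

/-- `x` is an endpoint of type `0` (resp. `1`) of the curve `c`, for `c`
equivalent to `C`. -/
def EndptType (c : Curve 3) (x : Pt 3) (ty : ℕ) : Prop :=
  ∃ f, PosIsom f ∧ curveTrace c = Trace.map f (listTrace CList) ∧
    x = f (if ty = 0 then p3 0 0 0 else p3 2 0 0)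

/-- Integer vectors. -/
abbrev IVec := Fin 3 → ℤ

/-- The inclusion of `ℤ³` into `ℝ³`. -/
def emb (v : IVec) : Pt 3 := toPt3 fun i => (v i : ℝ)

@[simp] lemma toPt3_apply (f : Fin 3 → ℝ) (i : Fin 3) : toPt3 f i = f i := rfl

@[simp] lemma emb_apply (v : IVec) (i : Fin 3) : emb v i = (v i : ℝ) := rfl

lemma p3_eq_emb (a b c : ℤ) : p3 a b c = emb ![a, b, c] := by
  ext i
  fin_cases i <;> simp [p3]

lemma emb_add (v w : IVec) : emb (v + w) = emb v + emb w := by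
  ext i
  simp

lemma emb_sub (v w : IVec) : emb (v - w) = emb v - emb w := by
  ext i
  simp

lemma emb_injective : Function.Injective emb := by
  intro v w h
  funext i
  have := congrArg (fun p : Pt 3 => p i) h
  simpa using this

lemma emb_zero : emb 0 = 0 := by
  ext i
  simp

lemma uvec_eq_emb (i : Fin 3) : uvec 3 i = emb (Pi.single i 1) := by
  ext k
  by_cases h : k = i
  · subst h
    simp [uvec]
  · simp [uvec, h]

lemma latt_iff_exists_emb (p : Pt 3) : latt p ↔ ∃ v, p = emb v := by
  constructor
  · intro h
    choose v hv using h
    exact ⟨v, by ext i; simp [hv]⟩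
  · rintro ⟨v, rfl⟩ i
    exact ⟨v i, rfl⟩

lemma latt_emb (v : IVec) : latt (emb v) := (latt_iff_exists_emb _).2 ⟨v, rfl⟩

/-- The vertices of `C`, as integer vectors. -/
def cVert : List IVec :=
  [![0, 0, 0], ![0, -1, 0], ![0, -1, -1], ![0, 0, -1], ![1, 0, -1],
   ![1, -1, -1], ![1, -1, 0], ![1, 0, 0], ![2, 0, 0]]

lemma cList_eq_map_emb : CList = cVert.map emb := by
  simp [CList, cVert, p3_eq_emb]

/-- The `j`-th vertex of `C`, as an integer vector. -/
def cv (j : ℕ) : IVec := cVert.getD j 0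

lemma getD_map_emb (L : List IVec) (j : ℕ) : (L.map emb).getD j 0 = emb (L.getD j 0) := by
  rw [← emb_zero, List.getD_map]

lemma cList_getD (j : ℕ) : CList.getD j 0 = emb (cv j) := by
  rw [cList_eq_map_emb, getD_map_emb, cv]

lemma cList_length : CList.length = 9 := rfl

/-- The square of the distance between two integer vectors. -/
def sqDist (v w : IVec) : ℤ := ∑ i, (v i - w i) ^ 2

lemma dist_emb_sq (v w : IVec) : dist (emb v) (emb w) ^ 2 = (sqDist v w : ℝ) := by
  rw [EuclideanSpace.dist_eq, Real.sq_sqrt (by positivity)]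
  simp [sqDist, Real.dist_eq]

lemma sqDist_eq_of_dist_eq {a b c d : IVec} (h : dist (emb a) (emb b) = dist (emb c) (emb d)) :
    sqDist a b = sqDist c d := by
  have := dist_emb_sq a b
  rw [h, dist_emb_sq] at this
  exact_mod_cast this.symm

lemma PosIsom.dist_eq {f : Pt 3 → Pt 3} (hf : PosIsom f) (x y : Pt 3) :
    dist (f x) (f y) = dist x y := by
  obtain ⟨g, t, h, -⟩ := hf
  rw [h, h, dist_add_right, g.dist_map]

lemma PosIsom.injective {f : Pt 3 → Pt 3} (hf : PosIsom f) : Function.Injective f := by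
  intro x y h
  rw [← dist_eq_zero, ← hf.dist_eq, h, dist_self]

lemma PosIsom.comp {f g : Pt 3 → Pt 3} (hf : PosIsom f) (hg : PosIsom g) :
    PosIsom fun x => f (g x) := by
  obtain ⟨F, t, h, hF⟩ := hf
  obtain ⟨G, s, h', hG⟩ := hg
  refine ⟨G.trans F, F s + t, fun x => ?_, ?_⟩
  · simp [h, h', add_assoc]
  · have : (G.trans F).toLinearEquiv.toLinearMap =
        F.toLinearEquiv.toLinearMap ∘ₗ G.toLinearEquiv.toLinearMap := rfl
    rw [this, LinearMap.det_comp]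
    exact mul_pos hF hG

lemma posIsom_add_const (t : Pt 3) : PosIsom fun x => x + t :=
  ⟨LinearIsometryEquiv.refl ℝ _, t, fun _ => rfl, by
    have : (LinearIsometryEquiv.refl ℝ (Pt 3)).toLinearEquiv.toLinearMap = LinearMap.id := rfl
    rw [this, LinearMap.det_id]
    exact one_pos⟩

lemma cv_injOn {j k : ℕ} (hj : j < 9) (hk : k < 9) (h : cv j = cv k) : j = k := by
  have key : ∀ j k : Fin 9, cv j = cv k → j = k := by decide +kernel
  exact congrArg Fin.val (key ⟨j, hj⟩ ⟨k, hk⟩ h)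

/-- The image of the `j`-th segment of `C` under `f`. -/
def segImage (f : Pt 3 → Pt 3) (j : ℕ) : Sym2 (Pt 3) := s(f (emb (cv j)), f (emb (cv (j + 1))))

/-- The image of the trace of `C` under `f`. -/
def imageTrace (f : Pt 3 → Pt 3) : Trace 3 := Trace.map f (listTrace CList)

lemma mem_imageTrace_segs {f : Pt 3 → Pt 3} {S : Sym2 (Pt 3)} :
    S ∈ (imageTrace f).segs ↔ ∃ j < 8, S = segImage f j := by
  simp only [imageTrace, Trace.map, listTrace, listSegs, cList_getD, cList_length, segImage]
  constructor
  · rintro ⟨_, ⟨j, hj, rfl⟩, rfl⟩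
    exact ⟨j, by omega, rfl⟩
  · rintro ⟨j, hj, rfl⟩
    exact ⟨_, ⟨j, by omega, rfl⟩, rfl⟩

lemma imageTrace_conn_iff {f : Pt 3 → Pt 3} {S T : Sym2 (Pt 3)} :
    (imageTrace f).conn S T ↔ ∃ j < 7, (S = segImage f j ∧ T = segImage f (j + 1)) ∨
      (T = segImage f j ∧ S = segImage f (j + 1)) := by
  simp only [imageTrace, Trace.map, listTrace, listConn, cList_getD, cList_length, segImage]
  constructor
  · rintro ⟨_, _, ⟨j, hj, ⟨rfl, rfl⟩ | ⟨rfl, rfl⟩⟩, rfl, rfl⟩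
    · exact ⟨j, by omega, Or.inl ⟨rfl, rfl⟩⟩
    · exact ⟨j, by omega, Or.inr ⟨rfl, rfl⟩⟩
  · rintro ⟨j, hj, ⟨rfl, rfl⟩ | ⟨rfl, rfl⟩⟩
    · exact ⟨_, _, ⟨j, by omega, Or.inl ⟨rfl, rfl⟩⟩, rfl, rfl⟩
    · exact ⟨_, _, ⟨j, by omega, Or.inr ⟨rfl, rfl⟩⟩, rfl, rfl⟩

lemma exists_vertex_eq {f h : Pt 3 → Pt 3} (hfh : imageTrace f = imageTrace h) {j : ℕ}
    (hj : j < 9) : ∃ k < 9, f (emb (cv j)) = h (emb (cv k)) := by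
  obtain ⟨m, hm, hjm⟩ : ∃ m < 8, f (emb (cv j)) ∈ segImage f m := by
    by_cases h8 : j = 8
    · exact ⟨7, by omega, by subst h8; simp [segImage]⟩
    · exact ⟨j, by omega, by simp [segImage]⟩
  have hS : segImage f m ∈ (imageTrace h).segs := hfh ▸ mem_imageTrace_segs.2 ⟨m, hm, rfl⟩
  obtain ⟨k, hk, hSk⟩ := mem_imageTrace_segs.1 hS
  rw [hSk, segImage, Sym2.mem_iff] at hjm
  rcases hjm with h1 | h1
  · exact ⟨k, by omega, h1⟩
  · exact ⟨k + 1, by omega, h1⟩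

/-- The extremities of `C` are characterized by the distances to the other vertices, so that
they are preserved, in order, by any isometry preserving `C`. -/
lemma endpoints_eq {f h : Pt 3 → Pt 3} (hf : PosIsom f) (hh : PosIsom h)
    (hfh : imageTrace f = imageTrace h) :
    f (emb (cv 0)) = h (emb (cv 0)) ∧ f (emb (cv 8)) = h (emb (cv 8)) := by
  obtain ⟨k, hk, h0⟩ := exists_vertex_eq hfh (j := 0) (by omega)
  obtain ⟨m, hm, h8⟩ := exists_vertex_eq hfh (j := 8) (by omega)
  have hkm : sqDist (cv k) (cv m) = sqDist (cv 0) (cv 8) := by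
    apply sqDist_eq_of_dist_eq
    rw [← hh.dist_eq, ← h0, ← h8, hf.dist_eq]
  have hmax : ∀ j : Fin 9, sqDist (cv k) (cv j) ≤ 4 := by
    intro j
    obtain ⟨j', hj', e⟩ := exists_vertex_eq hfh.symm j.2
    have : sqDist (cv k) (cv j) = sqDist (cv 0) (cv j') := by
      apply sqDist_eq_of_dist_eq
      rw [← hh.dist_eq, ← h0, e, hf.dist_eq]
    rw [this]
    have key : ∀ j : Fin 9, sqDist (cv 0) (cv j) ≤ 4 := by decide +kernel
    exact key ⟨j', hj'⟩
  have key : ∀ k m : Fin 9, sqDist (cv k) (cv m) = sqDist (cv 0) (cv 8) →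
      (∀ j : Fin 9, sqDist (cv k) (cv j) ≤ 4) → k = 0 ∧ m = 8 := by decide +kernel
  obtain ⟨hk0, hm8⟩ := key ⟨k, hk⟩ ⟨m, hm⟩ hkm hmax
  have hk0 := congrArg Fin.val hk0
  have hm8 := congrArg Fin.val hm8
  simp only [Fin.val_zero] at hk0
  change m = 8 at hm8
  subst hk0 hm8
  exact ⟨h0, h8⟩

/-- A family of positive isometries such that the images of `C` form a covering of `ℝ³`. -/
structure TilingFamily (ι : Type) where
  f : ι → Pt 3 → Pt 3
  pos : ∀ i, PosIsom (f i)
  isLatt : ∀ i v, latt (f i (emb v))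
  step : ∀ i, ∀ j < 8, ∃ k, f i (emb (cv (j + 1))) = f i (emb (cv j)) + uvec 3 k ∨
    f i (emb (cv (j + 1))) = f i (emb (cv j)) - uvec 3 k
  uniq : ∀ i i' j j', j < 8 → j' < 8 → segImage (f i) j = segImage (f i') j' → i = i' ∧ j = j'
  cover : ∀ S, IsSeg S → ∃ i, ∃ j < 8, S = segImage (f i) j

/-- The union of a family of traces. -/
def unionTrace {ι : Type} (T : ι → Trace 3) : Trace 3 :=
  ⟨{S | ∃ i, S ∈ (T i).segs}, fun S S' => ∃ i, (T i).conn S S'⟩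

lemma sameCurve_iff {c d : Curve 3} : SameCurve c d ↔ curveTrace c = curveTrace d := by
  simp [SameCurve, curveTrace]

namespace Curve

variable {c : Curve 3}

lemma mem_dom_of_lt {a b i : ℤ} (ha : a ∈ c.dom) (hb : b ∈ c.dom) (h1 : a ≤ i) (h2 : i ≤ b) :
    i ∈ c.dom :=
  c.ordConn.out ha hb ⟨h1, h2⟩

lemma conn_symm {S T : Sym2 (Pt 3)} (h : c.conn S T) : c.conn T S := by
  obtain ⟨i, h1, h2, h3⟩ := h
  exact ⟨i, h1, h2, h3.symm⟩

lemma mem_segs_of_conn {S T : Sym2 (Pt 3)} (h : c.conn S T) : S ∈ c.segs := by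
  obtain ⟨i, h1, h2, h3⟩ := h
  have h0 : i ∈ c.dom := mem_dom_of_lt h1 h2 (by omega) (by omega)
  rcases h3 with ⟨rfl, -⟩ | ⟨-, rfl⟩
  · exact ⟨i - 1, h1, by simpa using h0, by simp⟩
  · exact ⟨i, h0, h2, rfl⟩

lemma v_add_one_ne {i : ℤ} (h0 : i ∈ c.dom) (h1 : i + 1 ∈ c.dom) : c.v (i + 1) ≠ c.v i := by
  obtain ⟨j, hj⟩ := c.step i h0 h1
  have hu : uvec 3 j ≠ 0 := by simp [uvec]
  rcases hj with hj | hj <;> simp [hj, hu]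

/-- A set of segments of a curve which contains one segment and is closed under connexion
contains all of them. -/
lemma segs_subset_of_closed {A : Set (Sym2 (Pt 3))} {S : Sym2 (Pt 3)} (hS : S ∈ c.segs)
    (hSA : S ∈ A) (hA : ∀ S T, S ∈ A → c.conn S T → T ∈ A) : c.segs ⊆ A := by
  obtain ⟨n, hn, hn1, rfl⟩ := hS
  have next : ∀ i, i ∈ c.dom → i + 1 + 1 ∈ c.dom →
      c.conn s(c.v i, c.v (i + 1)) s(c.v (i + 1), c.v (i + 1 + 1)) := fun i h0 h2 =>
    ⟨i + 1, by simpa using h0, h2, Or.inl ⟨by simp, rfl⟩⟩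
  rintro _ ⟨m, hm, hm1, rfl⟩
  rcases le_total n m with h | h
  · induction m, h using Int.leInduction with
    | base => exact hSA
    | succ m h ih =>
      have hm' : m ∈ c.dom := mem_dom_of_lt hn hm h (by omega)
      exact hA _ _ (ih hm' hm) (next m hm' hm1)
  · induction m, h using Int.leInductionDown with
    | base => exact hSA
    | pred m h ih =>
      have hm' : m + 1 ∈ c.dom := mem_dom_of_lt hm hn1 (by omega) (by omega)
      simp only [sub_add_cancel] at *
      have := next (m - 1) hm (by simpa using hm')
      simp only [sub_add_cancel] at this
      exact hA _ _ (ih hm1 hm') (conn_symm this)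

end Curve

namespace TilingFamily

variable {ι : Type} (F : TilingFamily ι)

/-- The trace of the covering. -/
def trace : Trace 3 := unionTrace fun i => imageTrace (F.f i)

lemma conn_of_trace_conn {i : ι} {S T : Sym2 (Pt 3)} (hS : S ∈ (imageTrace (F.f i)).segs)
    (h : F.trace.conn S T) : (imageTrace (F.f i)).conn S T := by
  obtain ⟨i', h⟩ := h
  obtain ⟨j, hj, rfl⟩ := mem_imageTrace_segs.1 hS
  obtain ⟨j', hj', h' | h'⟩ := imageTrace_conn_iff.1 h
  · obtain ⟨rfl, -⟩ := F.uniq _ _ _ _ hj (by omega) h'.1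
    exact h
  · obtain ⟨rfl, -⟩ := F.uniq _ _ _ _ hj (by omega) h'.2
    exact h

lemma mem_segs_of_conn {f : Pt 3 → Pt 3} {S T : Sym2 (Pt 3)} (h : (imageTrace f).conn S T) :
    S ∈ (imageTrace f).segs ∧ T ∈ (imageTrace f).segs := by
  obtain ⟨j, hj, ⟨rfl, rfl⟩ | ⟨rfl, rfl⟩⟩ := imageTrace_conn_iff.1 h
  · exact ⟨mem_imageTrace_segs.2 ⟨j, by omega, rfl⟩,
      mem_imageTrace_segs.2 ⟨j + 1, by omega, rfl⟩⟩
  · exact ⟨mem_imageTrace_segs.2 ⟨j + 1, by omega, rfl⟩,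
      mem_imageTrace_segs.2 ⟨j, by omega, rfl⟩⟩

lemma eq_of_imageTrace_eq {i i' : ι} (h : imageTrace (F.f i) = imageTrace (F.f i')) : i = i' := by
  have h0 : segImage (F.f i) 0 ∈ (imageTrace (F.f i')).segs :=
    h ▸ mem_imageTrace_segs.2 ⟨0, by omega, rfl⟩
  obtain ⟨j, hj, e⟩ := mem_imageTrace_segs.1 h0
  exact (F.uniq _ _ _ _ (by omega) hj e).1

section Members

variable {F} {E : Set (Curve 3)}

lemma curve_conn_of_trace_conn (hE : DisjSA E) (hT : traceOf E = F.trace)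
    {c : Curve 3} (hc : c ∈ E) {S T : Sym2 (Pt 3)} (hS : S ∈ c.segs)
    (h : F.trace.conn S T) : c.conn S T := by
  rw [← hT] at h
  obtain ⟨d, hd, h⟩ := h
  by_cases hcd : SameCurve c d
  · rw [hcd.2]
    exact h
  · exact absurd (Curve.mem_segs_of_conn h) (hE.2 c hc d hd hcd S hS)

/-- Two connected components of the trace with a common segment are equal. -/
lemma curveTrace_eq (hE : DisjSA E) (hT : traceOf E = F.trace)
    {c : Curve 3} (hc : c ∈ E) {i : ι} {S : Sym2 (Pt 3)} (hS : S ∈ c.segs)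
    (hS' : S ∈ (imageTrace (F.f i)).segs) : curveTrace c = imageTrace (F.f i) := by
  have toTrace : ∀ S T, c.conn S T → F.trace.conn S T := fun S T h => by
    rw [← hT]
    exact ⟨c, hc, h⟩
  have h1 : c.segs ⊆ (imageTrace (F.f i)).segs := by
    refine Curve.segs_subset_of_closed hS hS' fun S T hS h => ?_
    exact (mem_segs_of_conn (F.conn_of_trace_conn hS (toTrace S T h))).2
  have h2 : (imageTrace (F.f i)).segs ⊆ c.segs := by
    have closed : ∀ S T, S ∈ c.segs → (imageTrace (F.f i)).conn S T → T ∈ c.segs :=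
      fun S T hS h => Curve.mem_segs_of_conn
        (Curve.conn_symm (curve_conn_of_trace_conn hE hT hc hS ⟨i, h⟩))
    have hiff : ∀ j < 8, (segImage (F.f i) j ∈ c.segs ↔ segImage (F.f i) 0 ∈ c.segs) := by
      intro j hj
      induction j with
      | zero => rfl
      | succ j ih =>
        rw [← ih (by omega)]
        exact ⟨fun h => closed _ _ h (imageTrace_conn_iff.2 ⟨j, by omega, Or.inr ⟨rfl, rfl⟩⟩),
          fun h => closed _ _ h (imageTrace_conn_iff.2 ⟨j, by omega, Or.inl ⟨rfl, rfl⟩⟩)⟩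
    obtain ⟨j, hj, rfl⟩ := mem_imageTrace_segs.1 hS'
    rintro _ hS''
    obtain ⟨j', hj', rfl⟩ := mem_imageTrace_segs.1 hS''
    rwa [hiff j' hj', ← hiff j hj]
  have h3 : c.conn = (imageTrace (F.f i)).conn := by
    funext S T
    apply propext
    constructor
    · intro h
      exact F.conn_of_trace_conn (h1 (Curve.mem_segs_of_conn h)) (toTrace S T h)
    · intro h
      exact curve_conn_of_trace_conn hE hT hc (h2 (mem_segs_of_conn h).1) ⟨i, h⟩
  simp only [curveTrace, h1.antisymm h2, h3]

lemma exists_index (hE : DisjSA E) (hT : traceOf E = F.trace)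
    {c : Curve 3} (hc : c ∈ E) : ∃ i, curveTrace c = imageTrace (F.f i) := by
  obtain ⟨n, h0, h1⟩ := c.nontriv
  have hS : s(c.v n, c.v (n + 1)) ∈ c.segs := ⟨n, h0, h1, rfl⟩
  have : s(c.v n, c.v (n + 1)) ∈ (traceOf E).segs := ⟨c, hc, hS⟩
  rw [hT] at this
  obtain ⟨i, hi⟩ := this
  exact ⟨i, curveTrace_eq hE hT hc hS hi⟩

lemma exists_curve (hE : DisjSA E) (hT : traceOf E = F.trace) (i : ι) :
    ∃ c ∈ E, curveTrace c = imageTrace (F.f i) := by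
  have h0 : segImage (F.f i) 0 ∈ (imageTrace (F.f i)).segs :=
    mem_imageTrace_segs.2 ⟨0, by omega, rfl⟩
  have : segImage (F.f i) 0 ∈ (traceOf E).segs := by
    rw [hT]
    exact ⟨i, h0⟩
  obtain ⟨c, hc, hS⟩ := this
  exact ⟨c, hc, curveTrace_eq hE hT hc hS h0⟩

lemma isCovering (hE : DisjSA E) (hT : traceOf E = F.trace) : IsCovering E := by
  refine ⟨hE, fun S hS _ => ⟨?_, fun c hc d hd hSc hSd => ?_⟩⟩
  · obtain ⟨i, j, hj, rfl⟩ := F.cover S hS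
    obtain ⟨c, hc, e⟩ := exists_curve hE hT i
    refine ⟨c, hc, ?_⟩
    have : segImage (F.f i) j ∈ (curveTrace c).segs := e ▸ mem_imageTrace_segs.2 ⟨j, hj, rfl⟩
    exact this
  · by_contra h
    exact hE.2 c hc d hd h S hSc hSd

lemma hasExactly (hE : DisjSA E) (hT : traceOf E = F.trace)
    {ty j : ℕ} (hj : ty = 0 ∧ j = 0 ∨ ty = 1 ∧ j = 8) {x : Pt 3} {L : List ι}
    (hL : L.Nodup) (h : ∀ i, F.f i (emb (cv j)) = x ↔ i ∈ L) :
    HasExactly {c | c ∈ E ∧ EndptType c x ty} L.length := by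
  have hpt : (if ty = 0 then p3 0 0 0 else p3 2 0 0) = emb (cv j) := by
    rcases hj with ⟨rfl, rfl⟩ | ⟨rfl, rfl⟩ <;> simp [p3_eq_emb, cv, cVert]
  have key : ∀ c i, curveTrace c = imageTrace (F.f i) → (EndptType c x ty ↔ i ∈ L) := by
    intro c i hci
    rw [← h i]
    constructor
    · rintro ⟨g, hg, hcg, rfl⟩
      rw [hpt]
      have := endpoints_eq (F.pos i) hg (hci.symm.trans hcg)
      rcases hj with ⟨-, rfl⟩ | ⟨-, rfl⟩
      exacts [this.1, this.2]
    · rintro rfl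
      exact ⟨F.f i, F.pos i, hci, by rw [hpt]⟩
  choose γ hγ hγi using exists_curve hE hT
  refine ⟨L.map γ, by simp, ?_, ?_, ?_⟩
  · intro c hc
    obtain ⟨i, hi, rfl⟩ := List.mem_map.1 hc
    exact ⟨hγ i, (key _ i (hγi i)).2 hi⟩
  · rw [List.pairwise_map]
    refine hL.imp fun {i i'} hne hs => hne (F.eq_of_imageTrace_eq ?_)
    rw [← hγi, ← hγi, sameCurve_iff.1 hs]
  · rintro c ⟨hc, hcx⟩
    obtain ⟨i, hi⟩ := exists_index hE hT hc
    exact ⟨γ i, List.mem_map_of_mem ((key c i hi).1 hcx), sameCurve_iff.2 (by rw [hi, hγi])⟩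

end Members

end TilingFamily

/-- The image of `C` under an isometry has no other endpoints than the images of the endpoints
of `C`. -/
lemma Curve.IsEndpt.eq_or_eq {c : Curve 3} {f : Pt 3 → Pt 3} (hf : PosIsom f)
    (hc : c.SelfAvoiding) (h : curveTrace c = imageTrace f) {x : Pt 3} (hx : c.IsEndpt x) :
    x = f (emb (cv 0)) ∨ x = f (emb (cv 8)) := by
  have hw : ∀ {j k}, j < 9 → k < 9 → f (emb (cv j)) = f (emb (cv k)) → j = k :=
    fun hj hk e => cv_injOn hj hk (emb_injective (hf.injective e))
  have hsegs : ∀ S, S ∈ c.segs ↔ ∃ j < 8, S = segImage f j := fun S => by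
    rw [← mem_imageTrace_segs, ← h]
    rfl
  have hconn : ∀ S T, c.conn S T ↔ (imageTrace f).conn S T := fun S T => by
    rw [← h]
    rfl
  obtain ⟨n, hn, rfl, hnd⟩ := hx
  obtain ⟨a, ha, ha1⟩ := c.nontriv
  have hnd' : (n - 1 ∉ c.dom ∧ n + 1 ∈ c.dom) ∨ (n - 1 ∈ c.dom ∧ n + 1 ∉ c.dom) := by
    rcases hnd with h1 | h1
    · have : n ≤ a := by
        by_contra hlt
        exact h1 (mem_dom_of_lt ha hn (by omega) (by omega))
      exact Or.inl ⟨h1, mem_dom_of_lt hn ha1 (by omega) (by omega)⟩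
    · have : a + 1 ≤ n := by
        by_contra hlt
        exact h1 (mem_dom_of_lt hn ha1 (by omega) (by omega))
      exact Or.inr ⟨mem_dom_of_lt ha hn (by omega) (by omega), h1⟩
  obtain ⟨k, hk, hxk⟩ : ∃ k < 9, c.v n = f (emb (cv k)) := by
    obtain ⟨S, hS, hxS⟩ : ∃ S ∈ c.segs, c.v n ∈ S := by
      rcases hnd' with h1 | h1
      · exact ⟨_, ⟨n, hn, h1.2, rfl⟩, by simp⟩
      · exact ⟨_, ⟨n - 1, h1.1, by simpa using hn, rfl⟩, by simp⟩
    obtain ⟨j, hj, rfl⟩ := (hsegs S).1 hS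
    rcases Sym2.mem_iff.1 hxS with e | e
    · exact ⟨j, by omega, e⟩
    · exact ⟨j + 1, by omega, e⟩
  by_contra! hne
  have hk0 : k ≠ 0 := by
    rintro rfl
    exact hne.1 hxk
  have hk8 : k ≠ 8 := by
    rintro rfl
    exact hne.2 hxk
  obtain ⟨j, rfl⟩ := Nat.exists_eq_succ_of_ne_zero hk0
  rw [Nat.succ_eq_add_one] at *
  obtain ⟨m, hm0, hm1, hm⟩ := (hconn _ _).2 (imageTrace_conn_iff.2 ⟨j, by omega, Or.inl ⟨rfl, rfl⟩⟩)
  have hmd : m ∈ c.dom := mem_dom_of_lt hm0 hm1 (by omega) (by omega)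
  have hvm : c.v m = c.v n := by
    have e1 : c.v m ∈ segImage f j := by
      rcases hm with ⟨e, -⟩ | ⟨-, e⟩ <;> rw [e] <;> simp
    have e2 : c.v m ∈ segImage f (j + 1) := by
      rcases hm with ⟨-, e⟩ | ⟨e, -⟩ <;> rw [e] <;> simp
    rw [segImage, Sym2.mem_iff] at e1 e2
    rw [hxk]
    rcases e1 with e1 | e1
    · rcases e2 with e2 | e2
      · exact e2
      · have := hw (by omega) (by omega) (e1.symm.trans e2)
        omega
    · exact e1
  have hp : ∀ p, p ∈ c.dom → p + 1 ∈ c.dom → c.v n ∈ s(c.v p, c.v (p + 1)) →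
      p = m - 1 ∨ p = m := by
    intro p hp hp1 hmem
    obtain ⟨i, hi, e⟩ := (hsegs _).1 ⟨p, hp, hp1, rfl⟩
    have hij : i = j ∨ i = j + 1 := by
      rw [e, hxk, segImage, Sym2.mem_iff] at hmem
      rcases hmem with e' | e'
      · have := hw (by omega) (by omega) e'
        omega
      · have := hw (by omega) (by omega) e'
        omega
    have hm' : s(c.v p, c.v (p + 1)) = s(c.v (m - 1), c.v m) ∨
        s(c.v p, c.v (p + 1)) = s(c.v m, c.v (m + 1)) := by
      rw [e]
      rcases hij with rfl | rfl
      · rcases hm with hm | hm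
        exacts [Or.inl hm.1, Or.inr hm.2]
      · rcases hm with hm | hm
        exacts [Or.inr hm.2, Or.inl hm.1]
    rcases hm' with hm' | hm'
    · exact Or.inl (hc p (m - 1) hp hp1 hm0 (by simpa using hmd) (by simpa using hm'))
    · exact Or.inr (hc p m hp hp1 hmd hm1 hm')
  rcases hnd' with ⟨h0, h1⟩ | ⟨h0, h1⟩
  · rcases hp n hn h1 (by simp) with e | e
    · obtain rfl : m = n + 1 := by omega
      exact Curve.v_add_one_ne hn h1 hvm
    · exact h0 (e ▸ hm0)
  · rcases hp (n - 1) h0 (by simpa using hn) (by simp) with e | e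
    · obtain rfl : n = m := by omega
      exact h1 hm1
    · obtain rfl : n = m + 1 := by omega
      exact Curve.v_add_one_ne hmd hm1 hvm.symm

namespace TilingFamily

variable {ι : Type} (F : TilingFamily ι)

/-- The curve of index `i`. -/
def curve (i : ι) : Curve 3 where
  dom := Set.Icc 0 8
  ordConn := Set.ordConnected_Icc
  nontriv := ⟨0, by simp, by simp⟩
  v n := F.f i (emb (cv n.toNat))
  lattice n _ := F.isLatt i _
  step n h0 h1 := by
    rw [Set.mem_Icc] at h0 h1
    obtain ⟨k, rfl⟩ := Int.eq_ofNat_of_zero_le h0.1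
    exact F.step i k (by omega)
  noback n h0 h1 e := by
    rw [Set.mem_Icc] at h0 h1
    have := cv_injOn (by omega) (by omega) (emb_injective ((F.pos i).injective e))
    omega

lemma curveTrace_curve (i : ι) : curveTrace (F.curve i) = imageTrace (F.f i) := by
  have h1 : ∀ S, S ∈ (F.curve i).segs ↔ S ∈ (imageTrace (F.f i)).segs := by
    intro S
    rw [mem_imageTrace_segs]
    constructor
    · rintro ⟨n, h0, h1, rfl⟩
      simp only [curve, Set.mem_Icc] at h0 h1
      obtain ⟨k, rfl⟩ := Int.eq_ofNat_of_zero_le h0.1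
      exact ⟨k, by omega, rfl⟩
    · rintro ⟨j, hj, rfl⟩
      exact ⟨j, ⟨by omega, by omega⟩, ⟨by omega, by omega⟩, rfl⟩
  have h2 : ∀ S T, (F.curve i).conn S T ↔ (imageTrace (F.f i)).conn S T := by
    intro S T
    rw [imageTrace_conn_iff]
    constructor
    · rintro ⟨n, h0, h1, h⟩
      simp only [curve, Set.mem_Icc] at h0 h1
      obtain ⟨k, hk⟩ := Int.eq_ofNat_of_zero_le h0.1
      obtain rfl : n = (k : ℤ) + 1 := by omega
      rw [add_sub_cancel_right] at h
      exact ⟨k, by omega, h⟩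
    · rintro ⟨j, hj, h⟩
      refine ⟨(j : ℤ) + 1, ⟨by omega, by omega⟩, ⟨by omega, by omega⟩, ?_⟩
      rw [add_sub_cancel_right]
      exact h
  simp only [curveTrace]
  congr
  · exact Set.ext h1
  · funext S T
    exact propext (h2 S T)

lemma exists_covering : ∃ E : Set (Curve 3), DisjSA E ∧ traceOf E = F.trace := by
  have hseg : ∀ i S, S ∈ (F.curve i).segs → S ∈ (imageTrace (F.f i)).segs := fun i S h => by
    rw [← curveTrace_curve]
    exact h
  refine ⟨Set.range F.curve, ⟨?_, ?_⟩, ?_⟩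
  · rintro _ ⟨i, rfl⟩ n n' h0 h1 h0' h1' e
    simp only [curve, Set.mem_Icc] at h0 h1 h0' h1'
    obtain ⟨k, rfl⟩ := Int.eq_ofNat_of_zero_le h0.1
    obtain ⟨k', rfl⟩ := Int.eq_ofNat_of_zero_le h0'.1
    rw [(F.uniq i i k k' (by omega) (by omega) e).2]
  · rintro _ ⟨i, rfl⟩ _ ⟨i', rfl⟩ hne S hS hS'
    obtain ⟨j, hj, e⟩ := mem_imageTrace_segs.1 (hseg _ _ hS)
    obtain ⟨j', hj', e'⟩ := mem_imageTrace_segs.1 (hseg _ _ hS')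
    obtain ⟨rfl, -⟩ := F.uniq _ _ _ _ hj hj' (e.symm.trans e')
    exact hne ⟨rfl, rfl⟩
  · have hs : ∀ i, (F.curve i).segs = (imageTrace (F.f i)).segs := fun i => by
      rw [← curveTrace_curve]
      rfl
    have hc : ∀ i, (F.curve i).conn = (imageTrace (F.f i)).conn := fun i => by
      rw [← curveTrace_curve]
      rfl
    simp only [traceOf, trace, unionTrace, Set.exists_range_iff, hs, hc]

end TilingFamily

open Matrix in
/-- The linear map with a given integer matrix. -/
def intLin (M : Matrix (Fin 3) (Fin 3) ℤ) : Pt 3 →ₗ[ℝ] Pt 3 :=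
  toEuclideanLin (M.map (Int.cast : ℤ → ℝ))

lemma ofLp_intLin (M : Matrix (Fin 3) (Fin 3) ℤ) (x : Pt 3) :
    (intLin M x).ofLp = (M.map (Int.cast : ℤ → ℝ)).mulVec x.ofLp := rfl

lemma intLin_emb (M : Matrix (Fin 3) (Fin 3) ℤ) (v : IVec) :
    intLin M (emb v) = emb (M.mulVec v) := by
  ext i
  simp [ofLp_intLin, Matrix.mulVec, dotProduct]

lemma posIsom_intLin {M : Matrix (Fin 3) (Fin 3) ℤ} (h : M.transpose * M = 1) (hd : M.det = 1) :
    PosIsom (intLin M) := by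
  set N : Matrix (Fin 3) (Fin 3) ℝ := M.map (Int.cast : ℤ → ℝ) with hN
  have hNN : N.transpose * N = 1 := by
    have := congrArg (fun A : Matrix (Fin 3) (Fin 3) ℤ => A.map (Int.castRingHom ℝ)) h
    simp only [Matrix.map_mul] at this
    exact this.trans (by simp)
  have hNd : N.det = 1 := by
    have := (Int.castRingHom ℝ).map_det M
    rw [hd, map_one] at this
    exact this.symm
  have hnorm : ∀ x : Pt 3, ‖intLin M x‖ = ‖x‖ := by
    intro x
    have hx : ∀ y : Pt 3, ‖y‖ ^ 2 = dotProduct y.ofLp y.ofLp := fun y => by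
      simp [EuclideanSpace.norm_sq_eq, dotProduct, ← sq]
    rw [← sq_eq_sq₀ (norm_nonneg _) (norm_nonneg _), hx, hx, ofLp_intLin,
      Matrix.dotProduct_mulVec, Matrix.vecMul_mulVec, ← hN, hNN,
      Matrix.vecMul_one]
  let L : Pt 3 →ₗᵢ[ℝ] Pt 3 := ⟨intLin M, hnorm⟩
  refine ⟨L.toLinearIsometryEquiv rfl, 0, fun x => by simp [L], ?_⟩
  have : (L.toLinearIsometryEquiv rfl).toLinearEquiv.toLinearMap = intLin M := by
    ext x
    simp [L]
  rw [this, intLin, Matrix.toEuclideanLin, LinearMap.det_toLpLin, ← hN, hNd]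
  exact one_pos

/-- The linear parts of the isometries defining the four blocks. -/
def blockRot : Fin 4 → Matrix (Fin 3) (Fin 3) ℤ :=
  ![1, !![1, 0, 0; 0, -1, 0; 0, 0, -1], !![1, 0, 0; 0, 0, 1; 0, -1, 0],
    !![1, 0, 0; 0, 0, -1; 0, 1, 0]]

/-- The translation parts of the isometries defining the four blocks. -/
def blockOff : Fin 4 → IVec := ![0, ![2, 2, 0], ![2, 0, 2], ![0, 2, 2]]

/-- The rotations sending `C` to the six curves of `ℬ₀`. -/
def curveRot : Fin 6 → Matrix (Fin 3) (Fin 3) ℤ :=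
  ![1, !![-1, 0, 0; 0, 0, -1; 0, -1, 0], !![0, 0, 1; 1, 0, 0; 0, 1, 0],
    !![0, -1, 0; -1, 0, 0; 0, 0, -1], !![0, 1, 0; 0, 0, 1; 1, 0, 0],
    !![0, 0, -1; 0, -1, 0; -1, 0, 0]]

/-- The rotation sending `C` to a translate of the curve of a given index. -/
def rot (p : Fin 4 × Fin 6) : Matrix (Fin 3) (Fin 3) ℤ := blockRot p.1 * curveRot p.2

lemma rot_orthogonal (p : Fin 4 × Fin 6) : (rot p).transpose * rot p = 1 := by
  revert p
  decide +kernel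

lemma rot_det (p : Fin 4 × Fin 6) : (rot p).det = 1 := by
  simp only [Matrix.det_fin_three]
  revert p
  decide +kernel

/-- The `j`-th vertex of the curve of a given index. -/
def vert (p : Fin 4 × Fin 6) (j : ℕ) : IVec := (rot p).mulVec (cv j) + blockOff p.1

lemma vert_step (p : Fin 4 × Fin 6) (j : Fin 8) : ∃ k,
    vert p (j + 1) = vert p j + Pi.single k 1 ∨ vert p (j + 1) = vert p j - Pi.single k 1 := by
  revert p j
  decide +kernel

/-- An encoding of integer vectors modulo `8`. -/
def code (v : IVec) : ℕ := (v 0 % 8 + 8 * (v 1 % 8) + 64 * (v 2 % 8)).toNat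

lemma code_eq_code_iff {v w : IVec} : code v = code w ↔ ∀ k, v k % 8 = w k % 8 := by
  simp only [code, Fin.forall_fin_succ, Fin.forall_fin_zero]
  simp
  omega

lemma mem_indices (q : (Fin 4 × Fin 6) × Fin 8) :
    q ∈ (List.finRange 4 ×ˢ List.finRange 6) ×ˢ List.finRange 8 :=
  List.pair_mem_product.2 ⟨List.pair_mem_product.2 ⟨List.mem_finRange _, List.mem_finRange _⟩,
    List.mem_finRange _⟩

/-- The codes of the sums of the endpoints of the segments of the `24` curves. -/
def codeList : List ℕ := ((List.finRange 4 ×ˢ List.finRange 6) ×ˢ List.finRange 8).map fun q =>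
  code (vert q.1 q.2 + vert q.1 (q.2 + 1))

lemma codeList_nodup : codeList.Nodup := by
  decide +kernel

lemma mid_code_injective : Function.Injective fun q : (Fin 4 × Fin 6) × Fin 8 =>
    code (vert q.1 q.2 + vert q.1 (q.2 + 1)) := fun q q' h =>
  List.inj_on_of_nodup_map codeList_nodup (mem_indices q) (mem_indices q') h

lemma mem_codeList (a b c : Fin 4) (k : Fin 3) :
    code (2 • ![(a : ℤ), (b : ℤ), (c : ℤ)] + Pi.single k 1) ∈ codeList := by
  revert a b c k
  decide +kernel

/-- The isometry sending `C` to the curve of a given index. -/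
def motion (i : IVec × (Fin 4 × Fin 6)) : Pt 3 → Pt 3 := fun x =>
  intLin (rot i.2) x + emb (blockOff i.2.1 + 4 • i.1)

lemma motion_emb (i : IVec × (Fin 4 × Fin 6)) (v : IVec) :
    motion i (emb v) = emb ((rot i.2).mulVec v + blockOff i.2.1 + 4 • i.1) := by
  rw [motion, intLin_emb, ← emb_add, add_assoc]

lemma motion_cv (i : IVec × (Fin 4 × Fin 6)) (j : ℕ) :
    motion i (emb (cv j)) = emb (vert i.2 j + 4 • i.1) := by
  rw [motion_emb, vert]

lemma posIsom_motion (i : IVec × (Fin 4 × Fin 6)) : PosIsom (motion i) :=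
  (posIsom_add_const _).comp (posIsom_intLin (rot_orthogonal _) (rot_det _))

lemma motion_uniq (i i' : IVec × (Fin 4 × Fin 6)) (j j' : ℕ) (hj : j < 8) (hj' : j' < 8)
    (h : segImage (motion i) j = segImage (motion i') j') : i = i' ∧ j = j' := by
  have hsum : vert i.2 j + 4 • i.1 + (vert i.2 (j + 1) + 4 • i.1) =
      vert i'.2 j' + 4 • i'.1 + (vert i'.2 (j' + 1) + 4 • i'.1) := by
    simp only [segImage, motion_cv] at h
    rcases Sym2.eq_iff.1 h with ⟨h1, h2⟩ | ⟨h1, h2⟩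
    · rw [emb_injective h1, emb_injective h2]
    · rw [emb_injective h1, emb_injective h2, add_comm]
  have hk : ∀ k, vert i.2 j k + 4 * i.1 k + (vert i.2 (j + 1) k + 4 * i.1 k) =
      vert i'.2 j' k + 4 * i'.1 k + (vert i'.2 (j' + 1) k + 4 * i'.1 k) := fun k => by
    simpa using congrFun hsum k
  have hq : ((i.2, ⟨j, hj⟩) : (Fin 4 × Fin 6) × Fin 8) = (i'.2, ⟨j', hj'⟩) := by
    apply mid_code_injective
    simp only [code_eq_code_iff, Pi.add_apply]
    intro k
    have := hk k
    omega
  rw [Prod.mk.injEq, Fin.mk.injEq] at hq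
  obtain ⟨h2, rfl⟩ := hq
  refine ⟨Prod.ext (funext fun k => ?_) h2, rfl⟩
  have := hk k
  rw [h2] at this
  omega

lemma motion_cover (S : Sym2 (Pt 3)) (hS : IsSeg S) : ∃ i, ∃ j < 8, S = segImage (motion i) j := by
  obtain ⟨_, k, hx, rfl⟩ := hS
  obtain ⟨x, rfl⟩ := (latt_iff_exists_emb _).1 hx
  have hres : ∀ a : ℤ, ∃ r : Fin 4, ∃ q : ℤ, a = r + 4 * q := fun a =>
    ⟨⟨(a % 4).toNat, by omega⟩, a / 4, by simp; omega⟩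
  choose r q hrq using hres
  obtain ⟨⟨p, j⟩, -, hpj⟩ := List.mem_map.1 (mem_codeList (r (x 0)) (r (x 1)) (r (x 2)) k)
  rw [code_eq_code_iff] at hpj
  have hmod : ∀ l, (2 * x l + (Pi.single k 1 : IVec) l -
      (vert p j l + vert p (j + 1) l)) % 8 = 0 := by
    intro l
    have h1 := hpj l
    have h2 := hrq (x l)
    have h3 : (![((r (x 0) : ℕ) : ℤ), ((r (x 1) : ℕ) : ℤ), ((r (x 2) : ℕ) : ℤ)] : IVec) l =
        (r (x l) : ℕ) := by
      fin_cases l <;> rfl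
    simp only [Pi.add_apply, Pi.smul_apply, h3] at h1
    simp only [nsmul_eq_mul, Nat.cast_ofNat] at h1
    omega
  have hdvd : ∀ l, ∃ u : ℤ, 2 * x l + (Pi.single k 1 : IVec) l =
      vert p j l + vert p (j + 1) l + 8 * u := fun l => by
    obtain ⟨u, hu⟩ := Int.dvd_of_emod_eq_zero (hmod l)
    exact ⟨u, by omega⟩
  choose u hu using hdvd
  refine ⟨(u, p), j, j.2, ?_⟩
  rw [segImage, motion_cv, motion_cv, uvec_eq_emb, ← emb_add, Sym2.eq_iff]
  obtain ⟨m, hm⟩ := vert_step p j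
  have hmk : m = k := by
    have h1 := hu k
    by_contra hne
    rcases hm with hm | hm <;> rw [hm] at h1 <;> simp [Ne.symm hne] at h1 <;> omega
  subst hmk
  rcases hm with hm | hm
  · left
    have hx : x = vert p j + 4 • u := by
      funext l
      have := hu l
      rw [hm] at this
      simp at this ⊢
      omega
    rw [hm, hx]
    refine ⟨rfl, congrArg emb ?_⟩
    abel
  · right
    have hx : x = vert p j - Pi.single m 1 + 4 • u := by
      funext l
      have := hu l
      rw [hm] at this
      simp at this ⊢
      omega
    rw [hm, hx]
    refine ⟨rfl, congrArg emb ?_⟩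
    abel

/-- The family of isometries defining `𝒞`. -/
def baseFamily : TilingFamily (IVec × (Fin 4 × Fin 6)) where
  f := motion
  pos := posIsom_motion
  isLatt i v := by
    rw [motion_emb]
    exact latt_emb _
  step i j hj := by
    obtain ⟨k, hk⟩ := vert_step i.2 ⟨j, hj⟩
    refine ⟨k, ?_⟩
    simp only [motion_cv, uvec_eq_emb, ← emb_add, ← emb_sub]
    rcases hk with hk | hk <;> simp only at hk <;> rw [hk]
    · exact Or.inl (congrArg emb (by abel))
    · exact Or.inr (congrArg emb (by abel))
  uniq := motion_uniq
  cover := motion_cover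

lemma Trace.map_map {n : ℕ} (f g : Pt n → Pt n) (T : Trace n) :
    Trace.map f (Trace.map g T) = Trace.map (fun x => f (g x)) T := by
  simp only [Trace.map]
  congr 1
  · rw [Set.image_image]
    refine Set.image_congr fun S _ => ?_
    rw [Sym2.map_map]
    rfl
  · funext S S'
    apply propext
    constructor
    · rintro ⟨_, _, ⟨A, B, h, rfl, rfl⟩, rfl, rfl⟩
      exact ⟨A, B, h, Sym2.map_map .., Sym2.map_map ..⟩
    · rintro ⟨A, B, h, rfl, rfl⟩
      exact ⟨_, _, ⟨A, B, h, rfl, rfl⟩, (Sym2.map_map ..).symm, (Sym2.map_map ..).symm⟩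

lemma map_unionTrace {ι : Type} (f : Pt 3 → Pt 3) (T : ι → Trace 3) :
    Trace.map f (unionTrace T) = unionTrace fun i => Trace.map f (T i) := by
  simp only [Trace.map, unionTrace]
  congr 1
  · ext S
    constructor
    · rintro ⟨A, ⟨i, hA⟩, rfl⟩
      exact ⟨i, A, hA, rfl⟩
    · rintro ⟨i, A, hA, rfl⟩
      exact ⟨A, ⟨i, hA⟩, rfl⟩
  · funext S S'
    apply propext
    constructor
    · rintro ⟨A, B, ⟨i, h⟩, e⟩
      exact ⟨i, A, B, h, e⟩
    · rintro ⟨i, A, B, h, e⟩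
      exact ⟨A, B, ⟨i, h⟩, e⟩

lemma map_imageTrace (f g : Pt 3 → Pt 3) :
    Trace.map f (imageTrace g) = imageTrace fun x => f (g x) :=
  Trace.map_map f g _

lemma listTrace_map (f : Pt 3 → Pt 3) (L : List (Pt 3)) :
    listTrace (L.map f) = Trace.map f (listTrace L) := by
  have h : ∀ j, j < L.length → (L.map f).getD j 0 = f (L.getD j 0) := fun j hj => by
    rw [List.getD_eq_getElem _ _ (by simpa using hj), List.getD_eq_getElem _ _ hj,
      List.getElem_map]
  simp only [listTrace, Trace.map]
  congr 1
  · ext S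
    simp only [listSegs, List.length_map]
    constructor
    · rintro ⟨j, hj, rfl⟩
      exact ⟨_, ⟨j, hj, rfl⟩, by rw [h _ hj, h j (by omega)]; rfl⟩
    · rintro ⟨_, ⟨j, hj, rfl⟩, rfl⟩
      exact ⟨j, hj, by rw [h _ hj, h j (by omega)]; rfl⟩
  · funext S S'
    apply propext
    simp only [listConn, List.length_map]
    constructor
    · rintro ⟨j, hj, e⟩
      rw [h _ hj, h j (by omega), h (j + 1) (by omega)] at e
      rcases e with ⟨rfl, rfl⟩ | ⟨rfl, rfl⟩
      · exact ⟨_, _, ⟨j, hj, Or.inl ⟨rfl, rfl⟩⟩, rfl, rfl⟩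
      · exact ⟨_, _, ⟨j, hj, Or.inr ⟨rfl, rfl⟩⟩, rfl, rfl⟩
    · rintro ⟨_, _, ⟨j, hj, e⟩, rfl, rfl⟩
      refine ⟨j, hj, ?_⟩
      rw [h _ hj, h j (by omega), h (j + 1) (by omega)]
      rcases e with ⟨rfl, rfl⟩ | ⟨rfl, rfl⟩
      · exact Or.inl ⟨rfl, rfl⟩
      · exact Or.inr ⟨rfl, rfl⟩

lemma b0_eq : B0 = (List.finRange 6).map fun k =>
    cVert.map fun v => emb ((curveRot k).mulVec v) := by
  have h : ((List.finRange 6).map fun k => cVert.map fun v => (curveRot k).mulVec v) =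
      [cVert,
        [![0, 0, 0], ![0, 0, 1], ![0, 1, 1], ![0, 1, 0], ![-1, 1, 0], ![-1, 1, 1],
          ![-1, 0, 1], ![-1, 0, 0], ![-2, 0, 0]],
        [![0, 0, 0], ![0, 0, -1], ![-1, 0, -1], ![-1, 0, 0], ![-1, 1, 0],
          ![-1, 1, -1], ![0, 1, -1], ![0, 1, 0], ![0, 2, 0]],
        [![0, 0, 0], ![1, 0, 0], ![1, 0, 1], ![0, 0, 1], ![0, -1, 1], ![1, -1, 1],
          ![1, -1, 0], ![0, -1, 0], ![0, -2, 0]],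
        [![0, 0, 0], ![-1, 0, 0], ![-1, -1, 0], ![0, -1, 0], ![0, -1, 1],
          ![-1, -1, 1], ![-1, 0, 1], ![0, 0, 1], ![0, 0, 2]],
        [![0, 0, 0], ![0, 1, 0], ![1, 1, 0], ![1, 0, 0], ![1, 0, -1], ![1, 1, -1],
          ![0, 1, -1], ![0, 0, -1], ![0, 0, -2]]] := by
    decide +kernel
  have h' := congrArg (List.map (List.map emb)) h
  rw [List.map_map] at h'
  simp only [Function.comp_def, List.map_map] at h'
  rw [h']
  simp only [B0, cList_eq_map_emb, p3_eq_emb, List.map_cons, List.map_nil]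

lemma blockLists_eq (b : Fin 4) :
    blockLists b = (List.finRange 6).map fun k => CList.map (motion (0, b, k)) := by
  have hmotion : ∀ k v, motion (0, b, k) (emb v) =
      emb ((blockRot b).mulVec ((curveRot k).mulVec v) + blockOff b) := fun k v => by
    rw [motion_emb, rot, Matrix.mulVec_mulVec, smul_zero, add_zero]
  have key : ∀ f : Pt 3 → Pt 3,
      (∀ v, f (emb v) = emb ((blockRot b).mulVec v + blockOff b)) →
      B0.map (List.map f) = (List.finRange 6).map fun k => CList.map (motion (0, b, k)) := by
    intro f hf
    simp only [b0_eq, cList_eq_map_emb, List.map_map, Function.comp_def, hf, hmotion]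
  fin_cases b
  · refine Eq.trans ?_ (key id fun v => ?_)
    · simp [blockLists]
    · simp [blockRot, blockOff]
  · refine key _ fun v => ?_
    ext i
    fin_cases i <;> simp [blockRot, blockOff, sigma3, p3, dotProduct,
      Fin.sum_univ_three] <;> ring
  · refine key _ fun v => ?_
    ext i
    fin_cases i <;> simp [blockRot, blockOff, tau3, p3, dotProduct,
      Fin.sum_univ_three] <;> ring
  · refine key _ fun v => ?_
    ext i
    fin_cases i <;> simp [blockRot, blockOff, ups3, p3, dotProduct,
      Fin.sum_univ_three] <;> ring

lemma emb_nsmul (m : ℕ) (v : IVec) : emb (m • v) = (m : ℝ) • emb v := by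
  ext i
  simp

lemma motion_add (i : IVec × (Fin 4 × Fin 6)) (w : IVec) (x : Pt 3) :
    motion i x + emb (4 • w) = motion (i.1 + w, i.2) x := by
  rw [motion, motion, add_assoc, ← emb_add, smul_add, add_assoc]

lemma cTrace_eq : CTrace = baseFamily.trace := by
  have h : ∀ (v : IVec) (b : Fin 4) (k : Fin 6),
      Trace.transl ((4 : ℝ) • emb v) (listTrace (CList.map (motion (0, b, k)))) =
        imageTrace (motion (v, b, k)) := fun v b k => by
    have h4 : (4 : ℝ) • emb v = emb (4 • v) := by
      rw [emb_nsmul, Nat.cast_ofNat]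
    rw [listTrace_map, Trace.transl, Trace.map_map]
    simp only [h4, motion_add, zero_add]
    rfl
  have key : ∀ P : Trace 3 → Prop, (∃ u : Pt 3, latt u ∧ ∃ (b : Fin 4), ∃ M ∈ blockLists b,
      P (Trace.transl ((4 : ℝ) • u) (listTrace M))) ↔ ∃ i, P (imageTrace (motion i)) := by
    intro P
    constructor
    · rintro ⟨_, hu, b, M, hM, hP⟩
      obtain ⟨v, rfl⟩ := (latt_iff_exists_emb _).1 hu
      rw [blockLists_eq] at hM
      obtain ⟨k, -, rfl⟩ := List.mem_map.1 hM
      exact ⟨(v, b, k), h v b k ▸ hP⟩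
    · rintro ⟨⟨v, b, k⟩, hP⟩
      refine ⟨emb v, latt_emb v, b, CList.map (motion (0, b, k)), ?_, (h v b k).symm ▸ hP⟩
      rw [blockLists_eq]
      exact List.mem_map_of_mem (List.mem_finRange k)
  simp only [CTrace, TilingFamily.trace, unionTrace, baseFamily]
  congr 1
  · ext S
    exact key fun T => S ∈ T.segs
  · funext S S'
    exact propext (key fun T => T.conn S S')

/-- The indices of the curves having, up to a translation in `4ℤ³`, their `j`-th vertex at
`2w`. -/
def indicesAt (j : ℕ) (w : IVec) : List (Fin 4 × Fin 6) :=
  (List.finRange 4 ×ˢ List.finRange 6).filter fun p => ∀ k, (2 * w k - vert p j k) % 4 = 0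

lemma indicesAt_length (j : ℕ) (w : IVec)
    (h : j = 0 ∧ Even (w 0 + w 1 + w 2) ∨ j = 8 ∧ ¬ Even (w 0 + w 1 + w 2)) :
    (indicesAt j w).length = 6 := by
  have key : ∀ a b c : Fin 2, (indicesAt (if Even (a.val + b.val + c.val) then 0 else 8)
      ![(a : ℤ), (b : ℤ), (c : ℤ)]).length = 6 := by
    decide +kernel
  have hres : ∀ a : ℤ, ∃ r : Fin 2, ∃ q : ℤ, a = r + 2 * q := fun a =>
    ⟨⟨(a % 2).toNat, by omega⟩, a / 2, by simp; omega⟩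
  choose r q hrq using hres
  have hj : j = if Even ((r (w 0)).val + (r (w 1)).val + (r (w 2)).val) then 0 else 8 := by
    have h0 := hrq (w 0)
    have h1 := hrq (w 1)
    have h2 := hrq (w 2)
    rw [Int.even_iff] at h
    simp only [Nat.even_iff]
    split_ifs <;> omega
  have hw : indicesAt j w =
      indicesAt j ![((r (w 0) : ℕ) : ℤ), ((r (w 1) : ℕ) : ℤ), ((r (w 2) : ℕ) : ℤ)] := by
    refine List.filter_congr fun p _ => ?_
    rw [decide_eq_decide]
    refine forall_congr' fun k => ?_
    have h2 := hrq (w k)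
    have h3 : (![((r (w 0) : ℕ) : ℤ), ((r (w 1) : ℕ) : ℤ), ((r (w 2) : ℕ) : ℤ)] : IVec) k =
        (r (w k) : ℕ) := by
      fin_cases k <;> rfl
    rw [h3]
    omega
  rw [hw, hj]
  exact key _ _ _

lemma exists_motion_indices (j : ℕ) (w : IVec)
    (h : j = 0 ∧ Even (w 0 + w 1 + w 2) ∨ j = 8 ∧ ¬ Even (w 0 + w 1 + w 2)) :
    ∃ L : List (IVec × (Fin 4 × Fin 6)), L.length = 6 ∧ L.Nodup ∧
      ∀ i, motion i (emb (cv j)) = emb (2 • w) ↔ i ∈ L := by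
  refine ⟨(indicesAt j w).map fun p => (fun k => (2 * w k - vert p j k) / 4, p), ?_, ?_, ?_⟩
  · rw [List.length_map, indicesAt_length j w h]
  · refine List.Nodup.map (fun p p' e => congrArg Prod.snd e) (List.Nodup.filter _ ?_)
    exact (List.nodup_finRange 4).product (List.nodup_finRange 6)
  · rintro ⟨u, p⟩
    have hmem : (u, p) ∈ (indicesAt j w).map
        (fun p => ((fun k => (2 * w k - vert p j k) / 4, p) : IVec × (Fin 4 × Fin 6))) ↔
        p ∈ indicesAt j w ∧ ∀ k, (2 * w k - vert p j k) / 4 = u k := by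
      rw [List.mem_map]
      constructor
      · rintro ⟨p', hp', e⟩
        obtain ⟨rfl, rfl⟩ := Prod.mk.inj e
        exact ⟨hp', fun _ => rfl⟩
      · rintro ⟨hp, hu⟩
        exact ⟨p, hp, Prod.ext (funext hu) rfl⟩
    have hp : p ∈ List.finRange 4 ×ˢ List.finRange 6 :=
      List.pair_mem_product.2 ⟨List.mem_finRange _, List.mem_finRange _⟩
    rw [hmem, indicesAt, List.mem_filter, decide_eq_true_iff, motion_cv, emb_injective.eq_iff,
      funext_iff]
    simp only [hp, true_and, ← forall_and]
    refine forall_congr' fun k => ?_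
    simp only [Pi.add_apply, Pi.smul_apply]
    simp only [nsmul_eq_mul, Nat.cast_ofNat]
    omega

lemma exists_motion_endpoint (i : IVec × (Fin 4 × Fin 6)) (j : ℕ) (hj : j = 0 ∨ j = 8) :
    ∃ w : IVec, motion i (emb (cv j)) = emb (2 • w) := by
  have key : ∀ p k, vert p 0 k % 2 = 0 ∧ vert p 8 k % 2 = 0 := by
    decide +kernel
  refine ⟨fun k => vert i.2 j k / 2 + 2 * i.1 k, ?_⟩
  rw [motion_cv]
  congr 1
  funext k
  have h := key i.2 k
  simp only [Pi.add_apply, Pi.smul_apply]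
  simp only [nsmul_eq_mul, Nat.cast_ofNat]
  rcases hj with rfl | rfl <;> omega

lemma emb_two_smul (w : IVec) : emb (2 • w) = p3 (2 * w 0) (2 * w 1) (2 * w 2) := by
  rw [p3_eq_emb]
  congr 1
  funext k
  fin_cases k <;> simp

lemma imageTrace_id : imageTrace (fun x => x) = listTrace CList := by
  have h := listTrace_map (fun x => x) CList
  rw [List.map_id'] at h
  exact h.symm

/-- The properties of a family of isometries which imply those of the coverings `𝒞₁`
and `𝒞₂`. -/
structure TilingFamily.IsRegular {ι : Type} (F : TilingFamily ι) : Prop where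
  exists_id : ∃ i, ∀ x, F.f i x = x
  exists_add : ∀ i w, ∃ i', ∀ x, F.f i x + emb (4 • w) = F.f i' x
  exists_indices : ∀ (j : ℕ) (w : IVec),
    (j = 0 ∧ Even (w 0 + w 1 + w 2) ∨ j = 8 ∧ ¬ Even (w 0 + w 1 + w 2)) →
    ∃ L : List ι, L.length = 6 ∧ L.Nodup ∧ ∀ i, F.f i (emb (cv j)) = emb (2 • w) ↔ i ∈ L
  exists_endpoint : ∀ i j, (j = 0 ∨ j = 8) → ∃ w : IVec, F.f i (emb (cv j)) = emb (2 • w)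

lemma baseFamily_isRegular : baseFamily.IsRegular where
  exists_id := by
    refine ⟨(0, 0, 0), fun x => ?_⟩
    ext k
    simp [baseFamily, motion, rot, blockRot, curveRot, blockOff, intLin]
  exists_add i w := ⟨(i.1 + w, i.2), fun x => motion_add i w x⟩
  exists_indices := exists_motion_indices
  exists_endpoint := exists_motion_endpoint

/-- The matrix of the isometry exchanging the two coverings. -/
def swapMat : Matrix (Fin 3) (Fin 3) ℤ := !![0, -1, 0; -1, 0, 0; 0, 0, -1]

lemma posIsom_swap : PosIsom (intLin swapMat) :=
  posIsom_intLin (by decide +kernel) (by rw [Matrix.det_fin_three]; decide +kernel)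

lemma intLin_swapMat (x : Pt 3) : intLin swapMat x = toPt3 ![-(x 1), -(x 0), -(x 2)] := by
  ext k
  fin_cases k <;> simp [ofLp_intLin, swapMat, Matrix.mulVec, dotProduct,
    Fin.sum_univ_three]

lemma swap_swap (x : Pt 3) : intLin swapMat (intLin swapMat x) = x := by
  rw [intLin_swapMat, intLin_swapMat]
  ext k
  fin_cases k <;> simp

lemma swap_uvec (k : Fin 3) : ∃ l, intLin swapMat (uvec 3 k) = -uvec 3 l := by
  have key : ∀ k, ∃ l, swapMat.mulVec (Pi.single k 1) = -Pi.single l 1 := by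
    decide +kernel
  obtain ⟨l, hl⟩ := key k
  refine ⟨l, ?_⟩
  rw [uvec_eq_emb, uvec_eq_emb, intLin_emb, hl]
  ext r
  simp

lemma isSeg_swap {S : Sym2 (Pt 3)} (hS : IsSeg S) : IsSeg (Sym2.map (intLin swapMat) S) := by
  obtain ⟨x, k, hx, rfl⟩ := hS
  obtain ⟨v, rfl⟩ := (latt_iff_exists_emb _).1 hx
  obtain ⟨l, hl⟩ := swap_uvec k
  refine ⟨emb (swapMat.mulVec v - Pi.single l 1), l, latt_emb _, ?_⟩
  rw [Sym2.map_mk, map_add, hl, intLin_emb, emb_sub, ← uvec_eq_emb, sub_add_cancel,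
    ← sub_eq_add_neg]
  exact Sym2.eq_swap

lemma segImage_swap (f : Pt 3 → Pt 3) (j : ℕ) :
    segImage (fun x => intLin swapMat (f x)) j = Sym2.map (intLin swapMat) (segImage f j) := rfl

/-- The image of a family of isometries by the isometry exchanging the two coverings. -/
def TilingFamily.swap {ι : Type} (F : TilingFamily ι) : TilingFamily ι where
  f i := fun x => intLin swapMat (F.f i x)
  pos i := posIsom_swap.comp (F.pos i)
  isLatt i v := by
    obtain ⟨w, hw⟩ := (latt_iff_exists_emb _).1 (F.isLatt i v)
    rw [hw, intLin_emb]
    exact latt_emb _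
  step i j hj := by
    obtain ⟨k, hk⟩ := F.step i j hj
    obtain ⟨l, hl⟩ := swap_uvec k
    refine ⟨l, ?_⟩
    rcases hk with hk | hk <;> rw [hk]
    · exact Or.inr (by rw [map_add, hl, sub_eq_add_neg])
    · exact Or.inl (by rw [map_sub, hl, sub_neg_eq_add])
  uniq i i' j j' hj hj' h := by
    rw [segImage_swap, segImage_swap] at h
    exact F.uniq i i' j j' hj hj' (Sym2.map.injective posIsom_swap.injective h)
  cover S hS := by
    obtain ⟨i, j, hj, h⟩ := F.cover _ (isSeg_swap hS)
    refine ⟨i, j, hj, ?_⟩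
    rw [segImage_swap, ← h, Sym2.map_map]
    have : (intLin swapMat : Pt 3 → Pt 3) ∘ intLin swapMat = id := funext swap_swap
    rw [this, Sym2.map_id, id]

lemma swap_trace {ι : Type} (F : TilingFamily ι) :
    F.swap.trace = Trace.map (intLin swapMat) F.trace := by
  rw [TilingFamily.trace, TilingFamily.trace, map_unionTrace]
  simp only [map_imageTrace]
  rfl

lemma baseFamily_swap_isRegular : baseFamily.swap.IsRegular where
  exists_id := by
    refine ⟨(0, 0, 3), fun x => ?_⟩
    have h : rot (0, 3) = swapMat := by decide +kernel
    have h' : motion (0, 0, 3) x = intLin swapMat x := by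
      rw [motion, h]
      simp [blockOff, emb_zero]
    change intLin swapMat (motion (0, 0, 3) x) = x
    rw [h', swap_swap]
  exists_add i w := by
    obtain ⟨i', hi'⟩ := baseFamily_isRegular.exists_add i (swapMat.mulVec w)
    refine ⟨i', fun x => ?_⟩
    change intLin swapMat (baseFamily.f i x) + emb (4 • w) = intLin swapMat (baseFamily.f i' x)
    rw [← hi' x, map_add, ← Matrix.mulVec_smul, ← intLin_emb, swap_swap]
  exists_indices j w h := by
    have hw : swapMat.mulVec w = ![-w 1, -w 0, -w 2] := by
      funext k
      fin_cases k <;> simp [swapMat, Matrix.mulVec, dotProduct, Fin.sum_univ_three]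
    obtain ⟨L, h6, hL, hiff⟩ := baseFamily_isRegular.exists_indices j (swapMat.mulVec w) (by
      rw [hw]
      simp only [Int.even_iff] at h ⊢
      simp only [Matrix.cons_val]
      omega)
    refine ⟨L, h6, hL, fun i => ?_⟩
    rw [← hiff, ← Matrix.mulVec_smul, ← intLin_emb]
    change intLin swapMat (baseFamily.f i (emb (cv j))) = _ ↔ _
    constructor
    · intro e
      rw [← e, swap_swap]
    · intro e
      rw [e, swap_swap]
  exists_endpoint i j hj := by
    obtain ⟨w, hw⟩ := baseFamily_isRegular.exists_endpoint i j hj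
    refine ⟨swapMat.mulVec w, ?_⟩
    change intLin swapMat (baseFamily.f i (emb (cv j))) = _
    rw [hw, intLin_emb, Matrix.mulVec_smul]

lemma TilingFamily.IsRegular.transl_trace {ι : Type} {F : TilingFamily ι} (hF : F.IsRegular)
    {t : Pt 3} (ht : inLat 4 t) : Trace.transl t F.trace = F.trace := by
  choose w hw using ht
  have ht : t = emb (4 • w) := by
    ext k
    simp [hw]
  have hneg : emb (4 • -w) + t = 0 := by
    rw [ht, ← emb_add, smul_neg, neg_add_cancel, emb_zero]
  have key : ∀ P : Trace 3 → Prop, (∃ i, P (imageTrace fun x => F.f i x + t)) ↔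
      ∃ i, P (imageTrace (F.f i)) := by
    intro P
    constructor
    · rintro ⟨i, hi⟩
      obtain ⟨i', hi'⟩ := hF.exists_add i w
      rw [ht, funext hi'] at hi
      exact ⟨i', hi⟩
    · rintro ⟨i, hi⟩
      obtain ⟨i', hi'⟩ := hF.exists_add i (-w)
      refine ⟨i', ?_⟩
      simpa only [← hi', add_assoc, hneg, add_zero] using hi
  rw [Trace.transl, TilingFamily.trace, map_unionTrace]
  simp only [map_imageTrace, unionTrace]
  congr 1
  · ext S
    exact key fun T => S ∈ T.segs
  · funext S S'
    exact propext (key fun T => T.conn S S')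

/-- Theorem 2.1: with `g` the positive isometry fixing `0` with
`g(e₁) = -e₂`, `g(e₂) = -e₁`, `g(e₃) = -e₃`, and `𝒞₁ = 𝒞`, `𝒞₂ = g(𝒞)`: the `𝒞ᵢ`
are two equivalent coverings of `ℝ³` by curves equivalent to `C`, both containing `C`;
each satisfies `4ℤ³ + 𝒞ᵢ = 𝒞ᵢ`; each `x = (2k,2l,2m)` with `k+l+m` even (resp. odd) is
an endpoint of type `0` (resp. `1`) of exactly `6` curves of `𝒞ᵢ`, and no other point
of `ℤ³` is an endpoint. -/
theorem statement8 :
    (∃ f : Pt 3 → Pt 3, PosIsom f ∧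
      Trace.map f CTrace =
        Trace.map (fun x => toPt3 ![-(x 1), -(x 0), -(x 2)]) CTrace) ∧
    ∀ T ∈ ({CTrace,
        Trace.map (fun x => toPt3 ![-(x 1), -(x 0), -(x 2)]) CTrace} : Set (Trace 3)),
      (∃ E : Set (Curve 3), DisjSA E ∧ traceOf E = T) ∧
      ∀ E : Set (Curve 3), DisjSA E → traceOf E = T →
        IsCovering E ∧
        (∀ c ∈ E, EquivToC c) ∧
        (∃ c ∈ E, curveTrace c = listTrace CList) ∧
        (∀ t : Pt 3, inLat 4 t → Trace.transl t T = T) ∧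
        (∀ k l m : ℤ, Even (k + l + m) →
          HasExactly {c | c ∈ E ∧ EndptType c (p3 (2 * k) (2 * l) (2 * m)) 0} 6) ∧
        (∀ k l m : ℤ, ¬ Even (k + l + m) →
          HasExactly {c | c ∈ E ∧ EndptType c (p3 (2 * k) (2 * l) (2 * m)) 1} 6) ∧
        (∀ x : Pt 3, latt x → (¬ ∃ k l m : ℤ, x = p3 (2 * k) (2 * l) (2 * m)) →
          ∀ c ∈ E, ¬ c.IsEndpt x) := by
  have main : ∀ {ι : Type} (F : TilingFamily ι), F.IsRegular →
      (∃ E : Set (Curve 3), DisjSA E ∧ traceOf E = F.trace) ∧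
      ∀ E : Set (Curve 3), DisjSA E → traceOf E = F.trace →
        IsCovering E ∧
        (∀ c ∈ E, EquivToC c) ∧
        (∃ c ∈ E, curveTrace c = listTrace CList) ∧
        (∀ t : Pt 3, inLat 4 t → Trace.transl t F.trace = F.trace) ∧
        (∀ k l m : ℤ, Even (k + l + m) →
          HasExactly {c | c ∈ E ∧ EndptType c (p3 (2 * k) (2 * l) (2 * m)) 0} 6) ∧
        (∀ k l m : ℤ, ¬ Even (k + l + m) →
          HasExactly {c | c ∈ E ∧ EndptType c (p3 (2 * k) (2 * l) (2 * m)) 1} 6) ∧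
        (∀ x : Pt 3, latt x → (¬ ∃ k l m : ℤ, x = p3 (2 * k) (2 * l) (2 * m)) →
          ∀ c ∈ E, ¬ c.IsEndpt x) := by
    intro ι F hF
    refine ⟨F.exists_covering, fun E hE hT => ⟨TilingFamily.isCovering hE hT, fun c hc => ?_, ?_,
      fun t ht => hF.transl_trace ht, fun k l m h => ?_, fun k l m h => ?_,
      fun x _ hx c hc hcx => hx ?_⟩⟩
    · obtain ⟨i, hi⟩ := TilingFamily.exists_index hE hT hc
      exact ⟨F.f i, F.pos i, hi⟩
    · obtain ⟨i, hi⟩ := hF.exists_id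
      obtain ⟨c, hc, e⟩ := TilingFamily.exists_curve hE hT i
      exact ⟨c, hc, by rw [e, funext hi, imageTrace_id]⟩
    · obtain ⟨L, h6, hL, hiff⟩ := hF.exists_indices 0 ![k, l, m] (Or.inl ⟨rfl, h⟩)
      rw [emb_two_smul] at hiff
      rw [← h6]
      exact TilingFamily.hasExactly hE hT (Or.inl ⟨rfl, rfl⟩) hL hiff
    · obtain ⟨L, h6, hL, hiff⟩ := hF.exists_indices 8 ![k, l, m] (Or.inr ⟨rfl, h⟩)
      rw [emb_two_smul] at hiff
      rw [← h6]
      exact TilingFamily.hasExactly hE hT (Or.inr ⟨rfl, rfl⟩) hL hiff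
    · obtain ⟨i, hi⟩ := TilingFamily.exists_index hE hT hc
      obtain ⟨j, hj, e⟩ : ∃ j, (j = 0 ∨ j = 8) ∧ x = F.f i (emb (cv j)) := by
        rcases hcx.eq_or_eq (F.pos i) (hE.1 c hc) hi with e | e
        exacts [⟨0, Or.inl rfl, e⟩, ⟨8, Or.inr rfl, e⟩]
      obtain ⟨w, hw⟩ := hF.exists_endpoint i j hj
      exact ⟨w 0, w 1, w 2, by rw [e, hw, emb_two_smul]⟩
  have hswap : (fun x : Pt 3 => toPt3 ![-(x 1), -(x 0), -(x 2)]) = intLin swapMat :=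
    funext fun x => (intLin_swapMat x).symm
  rw [hswap]
  refine ⟨⟨intLin swapMat, posIsom_swap, rfl⟩, ?_⟩
  rintro T (rfl | rfl)
  · rw [cTrace_eq]
    exact main _ baseFamily_isRegular
  · rw [cTrace_eq, ← swap_trace]
    exact main _ baseFamily_swap_isRegular

end
end Folding
end
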